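/- arXiv:1404.1721 — 14 statements merged into one kernel-verified Lean document; each statement's English description precedes it below -/
import Mathlib

section
/- Let I be a strongly ℓ-stable monomial ideal in P = k[x_1,…,x_n] and let A ∈ B_ℓ be an element of the ℓ-Borel group. Then the transformed ideal A·I (the image of I under the linear change of coordinates induced by A) equals I; in other words, every strongly ℓ-stable monomial ideal is invariant under the ℓ-Borel group. -/
open MvPolynomial

/-- `I` is a monomial ideal: it is generated by a set of terms. -/
def IsMonomialIdeal {k : Type*} [Field k] {n : ℕ}
    (I : Ideal (MvPolynomial (Fin n) k)) : Prop :=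
  ∃ S : Set (Fin n →₀ ℕ), I = Ideal.span ((fun a => monomial a (1 : k)) '' S)

/-- A monomial ideal `I` is strongly `ℓ`-stable: for every term `t ∈ I` (with exponent
vector `a`), every `j ≥ n - ℓ` (in 1-based indexing) with `x_j ∣ t` and every `i < j`,
the term `x_i · t / x_j` also lies in `I`.  (Variables are indexed by `Fin n`, whose
element `i` corresponds to the paper's variable `x_{i+1}`.) -/
def StronglyLStable {k : Type*} [Field k] {n : ℕ} (ℓ : ℕ)
    (I : Ideal (MvPolynomial (Fin n) k)) : Prop :=
  ∀ a : Fin n →₀ ℕ, monomial a (1 : k) ∈ I →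
    ∀ j : Fin n, n - ℓ ≤ (j : ℕ) + 1 → a j ≠ 0 →
      ∀ i : Fin n, i < j →
        monomial (a + Finsupp.single i 1 - Finsupp.single j 1) (1 : k) ∈ I

/-- The linear change of coordinates on `P = k[x_1, …, x_n]` induced by a matrix `A` of
the `ℓ`-Borel group: `x_i ↦ x_i` for `i < n - ℓ` and
`x_i ↦ a_{ii} x_i + ∑_{j = n-ℓ}^{i-1} a_{ij} x_j` for `i ≥ n - ℓ` (1-based indexing). -/
noncomputable def borelAction {k : Type*} [Field k] {n : ℕ} (ℓ : ℕ)
    (A : Matrix (Fin n) (Fin n) k) :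
    MvPolynomial (Fin n) k →ₐ[k] MvPolynomial (Fin n) k :=
  aeval fun i : Fin n =>
    if (i : ℕ) + 1 < n - ℓ then X i
    else ∑ j ∈ Finset.univ.filter (fun j : Fin n => n - ℓ ≤ (j : ℕ) + 1 ∧ j ≤ i),
      C (A i j) * X j

/-- Borel moves on a term of a strongly `ℓ`-stable ideal, with the trivial move allowed. -/
lemma StronglyLStable.monomial_add_single_mem {k : Type*} [Field k] {n ℓ : ℕ}
    {I : Ideal (MvPolynomial (Fin n) k)} (hstab : StronglyLStable ℓ I)
    {b : Fin n →₀ ℕ} {i j : Fin n} (hi : n - ℓ ≤ (i : ℕ) + 1) (hj : j ≤ i)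
    (h : monomial (b + Finsupp.single i 1) (1 : k) ∈ I) :
    monomial (b + Finsupp.single j 1) (1 : k) ∈ I := by
  rcases hj.eq_or_lt with rfl | hlt
  · exact h
  · have := hstab _ h i hi (by simp) j hlt
    rwa [add_right_comm, add_tsub_cancel_right] at this

lemma StronglyLStable.borelAction_monomial_mul_mem {k : Type*} [Field k] {n ℓ : ℕ}
    {I : Ideal (MvPolynomial (Fin n) k)} (hstab : StronglyLStable ℓ I)
    (A : Matrix (Fin n) (Fin n) k) (b : Fin n →₀ ℕ) :
    ∀ c : Fin n →₀ ℕ, monomial (b + c) (1 : k) ∈ I →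
      borelAction ℓ A (monomial b 1) * monomial c 1 ∈ I := by
  induction hd : b.degree generalizing b with
  | zero =>
    intro c hc
    obtain rfl := (Finsupp.degree_eq_zero_iff b).mp hd
    simpa [← one_def] using hc
  | succ d ih =>
    intro c hc
    obtain ⟨i, hi⟩ : ∃ i, b i ≠ 0 := by
      by_contra! h
      simp [show b = 0 from Finsupp.ext h] at hd
    obtain ⟨b, rfl⟩ : ∃ b', b = b' + Finsupp.single i 1 :=
      ⟨b - Finsupp.single i 1, (tsub_add_cancel_of_le
        (Finsupp.single_le_iff.mpr (Nat.one_le_iff_ne_zero.mpr hi))).symm⟩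
    have hb : b.degree = d := by simpa using hd
    rw [add_right_comm] at hc
    have hmul : monomial (b + Finsupp.single i 1) (1 : k) = monomial b 1 * X i := by
      rw [X, monomial_mul, one_mul]
    have hstep : ∀ j, monomial (b + c + Finsupp.single j 1) (1 : k) ∈ I →
        borelAction ℓ A (monomial b 1) * (X j * monomial c 1) ∈ I := by
      intro j hj
      rw [X, monomial_mul, one_mul, add_comm]
      exact ih b hb _ (by rwa [← add_assoc])
    have hXi : borelAction ℓ A (X i) = if (i : ℕ) + 1 < n - ℓ then X i
        else ∑ j ∈ Finset.univ.filter (fun j : Fin n => n - ℓ ≤ (j : ℕ) + 1 ∧ j ≤ i),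
          C (A i j) * X j := by
      simp [borelAction]
    rw [hmul, map_mul, hXi, mul_assoc]
    split_ifs with hlow
    · exact hstep i hc
    · rw [Finset.sum_mul, Finset.mul_sum]
      refine Ideal.sum_mem _ fun j hj => ?_
      rw [mul_assoc, mul_left_comm]
      exact Ideal.mul_mem_left _ _ (hstep j (hstab.monomial_add_single_mem
        (not_lt.mp hlow) (Finset.mem_filter.mp hj).2.2 hc))

lemma StronglyLStable.map_borelAction_le {k : Type*} [Field k] {n ℓ : ℕ}
    {I : Ideal (MvPolynomial (Fin n) k)} (hmon : IsMonomialIdeal I)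
    (hstab : StronglyLStable ℓ I) (A : Matrix (Fin n) (Fin n) k) :
    Ideal.map (borelAction ℓ A) I ≤ I := by
  obtain ⟨S, hS⟩ := hmon
  rw [Ideal.map_le_iff_le_comap]
  conv_lhs => rw [hS]
  rw [Ideal.span_le]
  rintro _ ⟨a, ha, rfl⟩
  have hmem : monomial a (1 : k) ∈ I := hS ▸ Ideal.subset_span ⟨a, ha, rfl⟩
  simpa using hstab.borelAction_monomial_mul_mem A a 0 (by simpa using hmem)

lemma borelAction_surjective {k : Type*} [Field k] {n : ℕ} (ℓ : ℕ)
    {A : Matrix (Fin n) (Fin n) k} (hA : ∀ i, A i i ≠ 0) :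
    Function.Surjective (borelAction ℓ A) := by
  have hX : ∀ i, X i ∈ (borelAction ℓ A).range := by
    intro i
    induction i using WellFoundedLT.induction with
    | ind i ih =>
      have hi : borelAction ℓ A (X i) ∈ (borelAction ℓ A).range := ⟨X i, rfl⟩
      simp only [borelAction, aeval_X] at hi
      split_ifs at hi with hlow
      · exact hi
      · rw [← Finset.add_sum_erase _ _ (a := i) (by simp; omega)] at hi
        have hsum : ∑ j ∈ (Finset.univ.filter
            (fun j : Fin n => n - ℓ ≤ (j : ℕ) + 1 ∧ j ≤ i)).erase i,
              C (A i j) * X j ∈ (borelAction ℓ A).range := by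
          refine Subalgebra.sum_mem _ fun j hj => ?_
          simp only [Finset.mem_erase, Finset.mem_filter] at hj
          simpa only [smul_eq_C_mul] using
            Subalgebra.smul_mem _ (ih j (lt_of_le_of_ne hj.2.2.2 hj.1)) (A i j)
        have h := Subalgebra.smul_mem _ (Subalgebra.sub_mem _ hi hsum) (A i i)⁻¹
        rwa [add_sub_cancel_right, ← smul_eq_C_mul, inv_smul_smul₀ (hA i)] at h
  rw [← AlgHom.range_eq_top, eq_top_iff, ← adjoin_range_X, Algebra.adjoin_le_iff]
  rintro _ ⟨i, rfl⟩
  exact hX i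

/-- In a Noetherian ring, an ideal mapped into itself by a surjective endomorphism is
mapped onto itself. -/
lemma Ideal.map_eq_self_of_map_le_of_surjective {R : Type*} [CommRing R] [IsNoetherianRing R]
    (f : R →+* R) (hf : Function.Surjective f) {I : Ideal R} (h : I.map f ≤ I) :
    I.map f = I := by
  have hle : I ≤ I.comap f := Ideal.map_le_iff_le_comap.mp h
  have hmono : Monotone fun m : ℕ => (Ideal.comap f)^[m] I :=
    Monotone.monotone_iterate_of_le_map (fun _ _ => Ideal.comap_mono) hle
  obtain ⟨m, hm⟩ := monotone_stabilizes_iff_noetherian.mpr ‹_› ⟨_, hmono⟩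
  have heq : (Ideal.comap f)^[m] I = (Ideal.comap f)^[m] (I.comap f) := hm (m + 1) m.le_succ
  have hI : I = I.comap f := (Ideal.comap_injective_of_surjective f hf).iterate m heq
  conv_lhs => rw [hI]
  exact Ideal.map_comap_of_surjective f hf I

/-- A strongly `ℓ`-stable monomial ideal is invariant under the `ℓ`-Borel group:
for every invertible lower triangular matrix `A` with `a_{ii} = 1` and `a_{ij} = 0`
(`j ≠ i`) for all rows `i < n - ℓ`, the transformed ideal `A · I` equals `I`. -/
theorem stronglyLStable_invariant_under_lBorel
    {k : Type*} [Field k] {n ℓ : ℕ} (hℓ : ℓ < n)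
    (I : Ideal (MvPolynomial (Fin n) k))
    (hmon : IsMonomialIdeal I) (hstab : StronglyLStable ℓ I)
    (A : Matrix (Fin n) (Fin n) k) (hunit : IsUnit A.det)
    (htri : ∀ i j : Fin n, i < j → A i j = 0)
    (hdiag : ∀ i : Fin n, (i : ℕ) + 1 < n - ℓ → A i i = 1)
    (hoff : ∀ i j : Fin n, (i : ℕ) + 1 < n - ℓ → j ≠ i → A i j = 0) :
    Ideal.map (borelAction ℓ A) I = I := by
  have hA : ∀ i, A i i ≠ 0 := by
    rw [Matrix.det_of_isLowerTriangular A (fun i j hij => htri i j hij), isUnit_iff_ne_zero,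
      Finset.prod_ne_zero_iff] at hunit
    exact fun i => hunit i (Finset.mem_univ i)
  exact Ideal.map_eq_self_of_map_le_of_surjective (borelAction ℓ A).toRingHom
    (borelAction_surjective ℓ hA) (hstab.map_borelAction_le hmon A)
end

section
/- A monomial ideal I in P = k[x_1,…,x_n] is ℓ-stable if and only if for every 0 ≤ i ≤ ℓ the colon ideal equality ⟨I, x_n, …, x_{n−i+1}⟩ : x_{n−i} = ⟨I, x_n, …, x_{n−i+1}⟩ : m holds, where m = ⟨x_1,…,x_n⟩ is the homogeneous maximal ideal. -/
open MvPolynomial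

/-- A monomial ideal `I` is `ℓ`-stable: for every term `t ∈ I` (with exponent vector `a`
and maximal variable index `w = w(t)`) with `w(t) ≥ n - ℓ` (1-based indexing) and every
`i < w(t)`, the term `x_i · t / x_{w(t)}` also lies in `I`. -/
def LStable {k : Type*} [Field k] {n : ℕ} (ℓ : ℕ)
    (I : Ideal (MvPolynomial (Fin n) k)) : Prop :=
  ∀ a : Fin n →₀ ℕ, monomial a (1 : k) ∈ I →
    ∀ w : Fin n, a w ≠ 0 → (∀ j, a j ≠ 0 → j ≤ w) →
      n - ℓ ≤ (w : ℕ) + 1 →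
      ∀ i : Fin n, i < w →
        monomial (a + Finsupp.single i 1 - Finsupp.single w 1) (1 : k) ∈ I

/-- Membership in the sum of a monomial ideal and an ideal generated by variables can be tested
on the terms in the support. -/
lemma IsMonomialIdeal.mem_sup_span_X_iff {k : Type*} [Field k] {n : ℕ}
    {I : Ideal (MvPolynomial (Fin n) k)} (hI : IsMonomialIdeal I) (p : Fin n → Prop)
    (f : MvPolynomial (Fin n) k) :
    f ∈ I ⊔ Ideal.span {g | ∃ j : Fin n, p j ∧ g = X j} ↔
      ∀ a ∈ f.support, monomial a (1 : k) ∈ I ∨ ∃ j, p j ∧ a j ≠ 0 := by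
  obtain ⟨S, rfl⟩ := hI
  have hX : {g : MvPolynomial (Fin n) k | ∃ j : Fin n, p j ∧ g = X j} =
      (fun a => monomial a (1 : k)) '' {a | ∃ j, p j ∧ a = Finsupp.single j 1} := by
    ext g
    constructor
    · rintro ⟨j, hj, rfl⟩
      exact ⟨_, ⟨j, hj, rfl⟩, rfl⟩
    · rintro ⟨_, ⟨j, hj, rfl⟩, rfl⟩
      exact ⟨j, hj, rfl⟩
  rw [hX, ← Ideal.span_union, ← Set.image_union, mem_ideal_span_monomial_image]
  refine forall₂_congr fun a _ => ?_
  have hS : monomial a (1 : k) ∈ Ideal.span ((fun b => monomial b (1 : k)) '' S) ↔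
      ∃ b ∈ S, b ≤ a := by
    simp [mem_ideal_span_monomial_image]
  rw [hS]
  constructor
  · rintro ⟨b, hb | ⟨j, hj, rfl⟩, hba⟩
    · exact Or.inl ⟨b, hb, hba⟩
    · refine Or.inr ⟨j, hj, ?_⟩
      have := hba j
      simp at this
      omega
  · rintro (⟨b, hb, hba⟩ | ⟨j, hj, haj⟩)
    · exact ⟨b, Or.inl hb, hba⟩
    · exact ⟨_, Or.inr ⟨j, hj, rfl⟩, Finsupp.single_le_iff.mpr (Nat.one_le_iff_ne_zero.mpr haj)⟩

/-- Multiplying by a variable shifts the terms in the support. -/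
lemma IsMonomialIdeal.mul_X_mem_sup_span_X_iff {k : Type*} [Field k] {n : ℕ}
    {I : Ideal (MvPolynomial (Fin n) k)} (hI : IsMonomialIdeal I) (p : Fin n → Prop)
    (f : MvPolynomial (Fin n) k) (i : Fin n) :
    f * X i ∈ I ⊔ Ideal.span {g | ∃ j : Fin n, p j ∧ g = X j} ↔
      ∀ a ∈ f.support, monomial (a + Finsupp.single i 1) (1 : k) ∈ I ∨
        ∃ j, p j ∧ (a + Finsupp.single i 1 : Fin n →₀ ℕ) j ≠ 0 := by
  rw [hI.mem_sup_span_X_iff, support_mul_X]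
  simp only [Finset.forall_mem_map, addRightEmbedding_apply]

/-- A monomial ideal `I` is `ℓ`-stable if and only if for all `0 ≤ i ≤ ℓ` the colon ideal
equality `⟨I, x_n, …, x_{n-i+1}⟩ : x_{n-i} = ⟨I, x_n, …, x_{n-i+1}⟩ : m` holds, where
`m = ⟨x_1, …, x_n⟩` is the homogeneous maximal ideal.  Membership in the two colon ideals
is spelled out elementwise: `f` lies in the left ideal iff `f · x_{n-i}` lies in
`J_i := ⟨I, x_n, …, x_{n-i+1}⟩`, and in the right one iff `f · h ∈ J_i` for all `h ∈ m`. -/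
theorem lStable_iff_colon
    {k : Type*} [Field k] {n ℓ : ℕ} (hℓ : ℓ < n)
    (I : Ideal (MvPolynomial (Fin n) k)) (hmon : IsMonomialIdeal I) :
    LStable ℓ I ↔
      ∀ i : ℕ, ∀ hi : i ≤ ℓ, ∀ f : MvPolynomial (Fin n) k,
        (f * X (⟨n - 1 - i, by omega⟩ : Fin n) ∈
            I ⊔ Ideal.span {g | ∃ j : Fin n, n - i ≤ (j : ℕ) ∧ g = X j}) ↔
        (∀ h ∈ Ideal.span (Set.range (X : Fin n → MvPolynomial (Fin n) k)),
          f * h ∈ I ⊔ Ideal.span {g | ∃ j : Fin n, n - i ≤ (j : ℕ) ∧ g = X j}) := by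
  constructor
  · intro hst i hi f
    refine ⟨fun hf h hh => ?_, fun hf => hf _ (Ideal.subset_span ⟨_, rfl⟩)⟩
    suffices hX : ∀ j : Fin n,
        f * X j ∈ I ⊔ Ideal.span {g | ∃ j : Fin n, n - i ≤ (j : ℕ) ∧ g = X j} by
      induction hh using Submodule.span_induction with
      | mem x hx => obtain ⟨j, rfl⟩ := hx; exact hX j
      | zero => simp
      | add x y _ _ hx hy => rw [mul_add]; exact Ideal.add_mem _ hx hy
      | smul c x _ hx =>
        rw [smul_eq_mul, mul_left_comm]
        exact Ideal.mul_mem_left _ _ hx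
    intro j
    rw [hmon.mul_X_mem_sup_span_X_iff] at hf ⊢
    intro a ha
    by_cases hlarge : ∃ l : Fin n, n - i ≤ (l : ℕ) ∧ a l ≠ 0
    · obtain ⟨l, hl, hal⟩ := hlarge
      exact Or.inr ⟨l, hl, by simp [hal]⟩
    push Not at hlarge
    by_cases hj : n - i ≤ (j : ℕ)
    · exact Or.inr ⟨j, hj, by simp⟩
    set w : Fin n := ⟨n - 1 - i, by omega⟩ with hw
    have hsmall : ∀ l, (a + Finsupp.single w 1 : Fin n →₀ ℕ) l ≠ 0 → l ≤ w := by
      intro l hl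
      by_contra hlw
      have hwl : w < l := not_le.mp hlw
      have hnl : n - i ≤ (l : ℕ) := by
        have : n - 1 - i < (l : ℕ) := hwl
        omega
      exact hl (by simp [hlarge l hnl, hwl.ne])
    left
    rcases hf a ha with hI | ⟨l, hl, hal⟩
    · have hjw : j ≤ w := Fin.le_def.mpr (by simp only [hw]; omega)
      rcases hjw.eq_or_lt with heq | hlt
      · rwa [heq]
      · have := hst _ hI w (by simp) hsmall (by simp only [hw]; omega) j hlt
        rwa [add_right_comm, add_tsub_cancel_right] at this
    · have : (l : ℕ) ≤ n - 1 - i := hsmall l hal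
      omega
  · intro hcolon a ha w haw hmax hwl i hiw
    have hsub : a - Finsupp.single w 1 + Finsupp.single w 1 = a :=
      tsub_add_cancel_of_le (Finsupp.single_le_iff.mpr (Nat.one_le_iff_ne_zero.mpr haw))
    have hweq : (⟨n - 1 - (n - 1 - w), by omega⟩ : Fin n) = w := Fin.ext (by simp only; omega)
    have key := (hcolon (n - 1 - w) (by omega) (monomial (a - Finsupp.single w 1) 1)).mp
      (by
        rw [hweq, X, monomial_mul, hsub, mul_one]
        exact Ideal.mem_sup_left ha)
      (X i) (Ideal.subset_span ⟨i, rfl⟩)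
    rw [hmon.mul_X_mem_sup_span_X_iff] at key
    have hshift : a + Finsupp.single i 1 - Finsupp.single w 1 =
        a - Finsupp.single w 1 + Finsupp.single i 1 := by
      rw [← hsub, add_right_comm, add_tsub_cancel_right, add_tsub_cancel_right]
    rw [hshift]
    rcases key (a - Finsupp.single w 1) (by simp) with hI | ⟨l, hl, hal⟩
    · exact hI
    · have hwl' : w < l := Fin.lt_def.mpr (by omega)
      have hal0 : a l = 0 := by
        by_contra h
        exact absurd (hmax l h) (not_le.mpr hwl')
      simp [hal0, (hiw.trans hwl').ne] at hal
end

section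
/- Let I be a monomial ideal in P = k[x_1,…,x_n] with Krull dimension dim(P/I) = D. If I is D-stable, then I is quasi-stable. -/
open MvPolynomial

/-- A monomial ideal `I` is quasi-stable: for every term `t ∈ I` (with exponent vector
`a` and maximal variable index `w = w(t)`) and every `j < w(t)` there is an `s ≥ 0` such
that `x_j^s · t / x_{w(t)}^d ∈ I`, where `d` is the exponent of `x_{w(t)}` in `t`. -/
def QuasiStable {k : Type*} [Field k] {n : ℕ}
    (I : Ideal (MvPolynomial (Fin n) k)) : Prop :=
  ∀ a : Fin n →₀ ℕ, monomial a (1 : k) ∈ I →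
    ∀ w : Fin n, a w ≠ 0 → (∀ j, a j ≠ 0 → j ≤ w) →
      ∀ j : Fin n, j < w → ∃ s : ℕ,
        monomial (a + Finsupp.single j s - Finsupp.single w (a w)) (1 : k) ∈ I

/-- Moving the full exponent of the last variable of a term to an earlier variable. -/
theorem LStable.shift_mem {k : Type*} [Field k] {n ℓ : ℕ}
    {I : Ideal (MvPolynomial (Fin n) k)} (hI : LStable ℓ I) {i w : Fin n} (hiw : i < w)
    (hw : n - ℓ ≤ (w : ℕ) + 1) (d : ℕ) :
    ∀ a : Fin n →₀ ℕ, monomial a (1 : k) ∈ I → (∀ j, a j ≠ 0 → j ≤ w) → a w = d →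
      monomial (a + Finsupp.single i d - Finsupp.single w d) (1 : k) ∈ I := by
  induction d with
  | zero => intro a ha _ _; simpa using ha
  | succ d ih =>
    intro a ha hmax had
    have h := ih _ (hI a ha w (by omega) hmax hw i hiw) (fun j hj => by
      by_contra hlt
      have h0 : a j = 0 := by
        by_contra h0
        exact hlt (hmax j h0)
      have hji : i ≠ j := by rintro rfl; exact hlt hiw.le
      simp [h0, Finsupp.single_eq_of_ne' hji] at hj) (by
      simp [had, Finsupp.single_eq_of_ne' hiw.ne])
    convert h using 3
    ext j
    simp only [Finsupp.tsub_apply, Finsupp.add_apply, Finsupp.single_apply]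
    split_ifs <;> omega

/-- A term supported on `x_i` and on later variables to which stability applies yields a
pure power of `x_i`. -/
theorem LStable.exists_pow_mem {k : Type*} [Field k] {n ℓ : ℕ}
    {I : Ideal (MvPolynomial (Fin n) k)} (hI : LStable ℓ I) (i : Fin n) (v : ℕ) :
    ∀ a : Fin n →₀ ℕ, monomial a (1 : k) ∈ I →
      (∀ j, a j ≠ 0 → j = i ∨ ((j : ℕ) < v ∧ i < j ∧ n - ℓ ≤ (j : ℕ) + 1)) →
      ∃ s : ℕ, monomial (Finsupp.single i s) (1 : k) ∈ I := by
  induction v with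
  | zero =>
    intro a ha hsupp
    refine ⟨a i, ?_⟩
    convert ha using 3
    ext j
    by_cases hj : i = j
    · simp [hj]
    · rw [Finsupp.single_eq_of_ne' hj]
      by_contra h
      rcases hsupp j (Ne.symm h) with h | h
      · exact hj h.symm
      · omega
  | succ v ih =>
    intro a ha hsupp
    by_cases hv : ∃ w : Fin n, (w : ℕ) = v ∧ w ≠ i ∧ a w ≠ 0
    · obtain ⟨w, rfl, hwi, haw⟩ := hv
      obtain ⟨-, hiw, hw⟩ := (hsupp w haw).resolve_left hwi
      refine ih _ (hI.shift_mem hiw hw (a w) a ha (fun j hj => ?_) rfl) (fun j hj => ?_)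
      · rcases hsupp j hj with rfl | h
        · exact hiw.le
        · exact Fin.le_def.2 (by omega)
      · by_cases hji : j = i
        · exact .inl hji
        · by_cases hjw : j = w
          · subst hjw
            simp [Finsupp.single_eq_of_ne hji] at hj
          · have haj : a j ≠ 0 := by
              simpa [Finsupp.single_eq_of_ne hji, Finsupp.single_eq_of_ne hjw] using hj
            obtain ⟨h1, h2⟩ := (hsupp j haj).resolve_left hji
            have : (j : ℕ) ≠ w := fun h => hjw (Fin.ext h)
            exact .inr ⟨by omega, h2⟩
    · push Not at hv
      refine ih a ha (fun j hj => or_iff_not_imp_left.2 fun hji => ?_)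
      obtain ⟨h1, h2⟩ := (hsupp j hj).resolve_left hji
      have : (j : ℕ) ≠ v := fun h => hj (hv j h hji)
      exact ⟨by omega, h2⟩

/-- If the monomial ideal `I` has no term in the variables indexed by `T`, then
`dim (P/I)` is at least the cardinality of `T`. -/
theorem IsMonomialIdeal.card_le_ringKrullDim {k : Type*} [Field k] {n : ℕ}
    {I : Ideal (MvPolynomial (Fin n) k)} (hI : IsMonomialIdeal I) (T : Finset (Fin n))
    (hT : ∀ a : Fin n →₀ ℕ, monomial a (1 : k) ∈ I → ∃ j, a j ≠ 0 ∧ j ∉ T) :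
    (T.card : WithBot ℕ∞) ≤ ringKrullDim (MvPolynomial (Fin n) k ⧸ I) := by
  obtain ⟨S, hS⟩ := hI
  let f : MvPolynomial (Fin n) k →ₐ[k] MvPolynomial T k :=
    killCompl (Subtype.val_injective : Function.Injective (Subtype.val : T → Fin n))
  have hf : ∀ p ∈ I, f p = 0 := by
    suffices I ≤ RingHom.ker f from fun p hp => this hp
    conv_lhs => rw [hS]
    rw [Ideal.span_le]
    rintro _ ⟨a, ha, rfl⟩
    obtain ⟨j, hj, hjT⟩ := hT a (hS ▸ Ideal.subset_span ⟨a, ha, rfl⟩)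
    change f (monomial a 1) = 0
    exact killCompl_monomial_eq_zero_of_notMem_range _ _ (Finsupp.mem_support_iff.2 hj)
      (by simpa using hjT)
  have hsurj : Function.Surjective (Ideal.Quotient.lift I (f : _ →+* MvPolynomial T k) hf) := by
    intro p
    exact ⟨Ideal.Quotient.mk I (rename Subtype.val p),
      killCompl_rename_app Subtype.val_injective p⟩
  have h := ringKrullDim_le_of_surjective _ hsurj
  rw [MvPolynomial.ringKrullDim_of_isNoetherianRing, ringKrullDim_eq_zero_of_field] at h
  simpa using h

/-- A `D`-stable monomial ideal, where `D = dim (P/I)` is the Krull dimension of the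
quotient ring, is quasi-stable. -/
theorem quasiStable_of_dStable
    {k : Type*} [Field k] {n D : ℕ} (hD : D < n)
    (I : Ideal (MvPolynomial (Fin n) k)) (hmon : IsMonomialIdeal I)
    (hdim : ringKrullDim (MvPolynomial (Fin n) k ⧸ I) = (D : WithBot (WithTop ℕ)))
    (hstab : LStable D I) :
    QuasiStable I := by
  intro a ha w haw hmax j hjw
  by_cases hw : n - D ≤ (w : ℕ) + 1
  · exact ⟨a w, hstab.shift_mem hjw hw (a w) a ha hmax rfl⟩
  have hjw' : (j : ℕ) < w := hjw
  obtain ⟨b, hb, hbT⟩ : ∃ b : Fin n →₀ ℕ, monomial b (1 : k) ∈ I ∧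
      ∀ l, b l ≠ 0 → l = j ∨ n - D ≤ (l : ℕ) := by
    by_contra! hcon
    let T : Finset (Fin n) := insert j (Finset.univ.filter fun l => ¬ (l : ℕ) < n - D)
    have hcard : T.card = D + 1 := by
      have h := Finset.card_filter_add_card_filter_not (s := Finset.univ)
        (fun l : Fin n => (l : ℕ) < n - D)
      rw [Fin.card_filter_val_lt, Finset.card_univ, Fintype.card_fin] at h
      rw [Finset.card_insert_of_notMem (by simp only [Finset.mem_filter]; omega)]
      omega
    have h := hmon.card_le_ringKrullDim T (fun b hb => by
      obtain ⟨l, hl, hlj, hlD⟩ := hcon b hb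
      exact ⟨l, hl, by simp only [T, Finset.mem_insert, Finset.mem_filter]; tauto⟩)
    rw [hdim, hcard] at h
    have : D + 1 ≤ D := by
      change ((D + 1 : ℕ) : WithBot ℕ∞) ≤ ((D : ℕ) : WithBot ℕ∞) at h
      exact_mod_cast h
    omega
  obtain ⟨s, hs⟩ := hstab.exists_pow_mem j n b hb (fun l hl => (hbT l hl).imp_right fun h =>
    ⟨l.2, Fin.lt_def.2 (by omega), by omega⟩)
  refine ⟨s, ?_⟩
  have hle : Finsupp.single j s ≤ a + Finsupp.single j s - Finsupp.single w (a w) := by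
    intro l
    simp only [Finsupp.tsub_apply, Finsupp.add_apply, Finsupp.single_apply]
    split_ifs <;> subst_vars <;> omega
  rw [← tsub_add_cancel_of_le hle, ← one_mul (1 : k), ← monomial_mul]
  exact I.mul_mem_left _ hs
end

section
/- Let I be an ℓ-stable monomial ideal in P = k[x_1,…,x_n]. Then for every 0 ≤ i ≤ ℓ the saturation equality ⟨I, x_n, …, x_{n−i+1}⟩ : x_{n−i}^∞ = ⟨I, x_n, …, x_{n−i+1}⟩ : m^∞ holds, where m = ⟨x_1,…,x_n⟩ is the homogeneous maximal ideal. -/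
open MvPolynomial

theorem IsMonomialIdeal.mem_iff {k : Type*} [Field k] {n : ℕ}
    {J : Ideal (MvPolynomial (Fin n) k)} (hJ : IsMonomialIdeal J)
    (f : MvPolynomial (Fin n) k) :
    f ∈ J ↔ ∀ a ∈ f.support, monomial a (1 : k) ∈ J := by
  classical
  obtain ⟨S, rfl⟩ := hJ
  simp [mem_ideal_span_monomial_image, support_monomial]

theorem IsMonomialIdeal.sup {k : Type*} [Field k] {n : ℕ}
    {I J : Ideal (MvPolynomial (Fin n) k)} (hI : IsMonomialIdeal I) (hJ : IsMonomialIdeal J) :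
    IsMonomialIdeal (I ⊔ J) := by
  obtain ⟨S, rfl⟩ := hI
  obtain ⟨T, rfl⟩ := hJ
  exact ⟨S ∪ T, by rw [Set.image_union, Ideal.span_union]⟩

theorem isMonomialIdeal_span_X {k : Type*} [Field k] {n : ℕ} (p : Fin n → Prop) :
    IsMonomialIdeal (Ideal.span {g : MvPolynomial (Fin n) k | ∃ j : Fin n, p j ∧ g = X j}) := by
  refine ⟨{a | ∃ j : Fin n, p j ∧ a = Finsupp.single j 1}, congrArg _ ?_⟩
  ext g
  constructor
  · rintro ⟨j, hj, rfl⟩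
    exact ⟨_, ⟨j, hj, rfl⟩, rfl⟩
  · rintro ⟨_, ⟨j, hj, rfl⟩, rfl⟩
    exact ⟨j, hj, rfl⟩

/-- A term lying in the sum of two monomial ideals lies in one of them. -/
theorem IsMonomialIdeal.monomial_mem_sup {k : Type*} [Field k] {n : ℕ}
    {I J : Ideal (MvPolynomial (Fin n) k)} (hI : IsMonomialIdeal I) (hJ : IsMonomialIdeal J)
    {a : Fin n →₀ ℕ} (ha : monomial a (1 : k) ∈ I ⊔ J) :
    monomial a (1 : k) ∈ I ∨ monomial a (1 : k) ∈ J := by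
  classical
  obtain ⟨S, rfl⟩ := hI
  obtain ⟨T, rfl⟩ := hJ
  rw [← Ideal.span_union, ← Set.image_union] at ha
  simp only [mem_ideal_span_monomial_image, support_monomial, one_ne_zero, if_false,
    Finset.mem_singleton, forall_eq, Set.mem_union] at ha ⊢
  obtain ⟨b, hb | hb, hba⟩ := ha
  · exact Or.inl ⟨b, hb, hba⟩
  · exact Or.inr ⟨b, hb, hba⟩

/-- In a monomial ideal, exchanging one variable for another may be checked on terms. -/
theorem IsMonomialIdeal.X_mul_mem_of_forall_monomial {k : Type*} [Field k] {n : ℕ}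
    {J : Ideal (MvPolynomial (Fin n) k)} (hJ : IsMonomialIdeal J) {p q : Fin n}
    (h : ∀ a, monomial (Finsupp.single p 1 + a) (1 : k) ∈ J →
      monomial (Finsupp.single q 1 + a) (1 : k) ∈ J)
    {f : MvPolynomial (Fin n) k} (hf : X p * f ∈ J) : X q * f ∈ J := by
  rw [hJ.mem_iff] at hf ⊢
  simp only [support_X_mul, Finset.mem_map, addLeftEmbedding_apply, forall_exists_index,
    and_imp, forall_apply_eq_imp_iff₂] at hf ⊢
  exact fun a ha => h a (hf a ha)

theorem monomial_mem_span_X {k : Type*} [Field k] {n : ℕ} {p : Fin n → Prop} {j : Fin n} (hj : p j)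
    {a : Fin n →₀ ℕ} (ha : a j ≠ 0) :
    monomial a (1 : k) ∈
      Ideal.span {g : MvPolynomial (Fin n) k | ∃ j : Fin n, p j ∧ g = X j} := by
  refine Ideal.mem_of_dvd _ ?_ (Ideal.subset_span ⟨j, hj, rfl⟩)
  exact X_dvd_monomial.2 (Or.inr ha)

theorem exists_ne_zero_of_monomial_mem_span_X {k : Type*} [Field k] {n : ℕ} {p : Fin n → Prop}
    {a : Fin n →₀ ℕ} (ha : monomial a (1 : k) ∈
      Ideal.span {g : MvPolynomial (Fin n) k | ∃ j : Fin n, p j ∧ g = X j}) :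
    ∃ j, p j ∧ a j ≠ 0 := by
  classical
  have hset : {g : MvPolynomial (Fin n) k | ∃ j : Fin n, p j ∧ g = X j} = X '' {j | p j} := by
    ext g
    simp [eq_comm]
  rw [hset, mem_ideal_span_X_image] at ha
  exact ha a (by simp [support_monomial])

/-- If multiplication into `J` by `x_p` forces multiplication into `J` by every variable, then
the same holds for powers of `x_p` and of the ideal generated by the variables. -/
theorem mul_mem_of_X_pow_mul_mem {k : Type*} [Field k] {n : ℕ}
    {J : Ideal (MvPolynomial (Fin n) k)} {p : Fin n}
    (h : ∀ q : Fin n, ∀ f : MvPolynomial (Fin n) k, X p * f ∈ J → X q * f ∈ J) (s : ℕ) :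
    ∀ f : MvPolynomial (Fin n) k, X p ^ s * f ∈ J →
      ∀ g ∈ (Ideal.span (Set.range (X : Fin n → MvPolynomial (Fin n) k))) ^ s, f * g ∈ J := by
  induction s with
  | zero =>
    intro f hf g _
    exact J.mul_mem_right _ (by simpa using hf)
  | succ s ih =>
    intro f hf g hg
    rw [pow_succ] at hg
    refine Submodule.mul_induction_on hg (fun u hu v hv => ?_) (fun u v hu hv => ?_)
    · have hpu : X p * (f * u) ∈ J := by
        have := ih (X p * f) (by rwa [← mul_assoc, ← pow_succ]) u hu
        rwa [mul_assoc] at this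
      rw [← mul_assoc]
      refine Submodule.span_induction (p := fun v _ => f * u * v ∈ J) ?_ ?_ ?_ ?_ hv
      · rintro _ ⟨q, rfl⟩
        rw [mul_comm]
        exact h q _ hpu
      · simp
      · intro x y _ _ hx hy
        rw [mul_add]
        exact J.add_mem hx hy
      · intro c x _ hx
        rw [smul_eq_mul, mul_left_comm]
        exact J.mul_mem_left c hx
    · rw [mul_add]
      exact J.add_mem hu hv

/-- For an `ℓ`-stable monomial ideal `I` and every `0 ≤ i ≤ ℓ`, the saturation equality
`⟨I, x_n, …, x_{n-i+1}⟩ : x_{n-i}^∞ = ⟨I, x_n, …, x_{n-i+1}⟩ : m^∞` holds, where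
`m = ⟨x_1, …, x_n⟩`.  Membership is spelled out elementwise: `f` lies in the left-hand
saturation iff `x_{n-i}^s · f ∈ J_i := ⟨I, x_n, …, x_{n-i+1}⟩` for some `s`, and in the
right-hand one iff `f · h ∈ J_i` for all `h ∈ m^s`, for some `s`. -/
theorem saturation_eq_of_lStable
    {k : Type*} [Field k] {n ℓ : ℕ} (hℓ : ℓ < n)
    (I : Ideal (MvPolynomial (Fin n) k)) (hmon : IsMonomialIdeal I)
    (hstab : LStable ℓ I) :
    ∀ i : ℕ, ∀ hi : i ≤ ℓ, ∀ f : MvPolynomial (Fin n) k,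
      (∃ s : ℕ, X (⟨n - 1 - i, by omega⟩ : Fin n) ^ s * f ∈
          I ⊔ Ideal.span {g | ∃ j : Fin n, n - i ≤ (j : ℕ) ∧ g = X j}) ↔
      (∃ s : ℕ, ∀ h ∈ (Ideal.span (Set.range (X : Fin n → MvPolynomial (Fin n) k))) ^ s,
          f * h ∈ I ⊔ Ideal.span {g | ∃ j : Fin n, n - i ≤ (j : ℕ) ∧ g = X j}) := by
  intro i hi f
  have hX := isMonomialIdeal_span_X (k := k) (fun j : Fin n => n - i ≤ (j : ℕ))
  constructor
  · rintro ⟨s, hs⟩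
    refine ⟨s, mul_mem_of_X_pow_mul_mem (fun q g hg => ?_) s f hs⟩
    refine (hmon.sup hX).X_mul_mem_of_forall_monomial (fun a ha => ?_) hg
    set p : Fin n := ⟨n - 1 - i, by omega⟩ with hp
    by_cases hbig : ∃ j : Fin n, n - i ≤ (j : ℕ) ∧ (Finsupp.single q 1 + a : Fin n →₀ ℕ) j ≠ 0
    · obtain ⟨j, hj, hja⟩ := hbig
      exact Ideal.mem_sup_right (monomial_mem_span_X (p := fun j : Fin n => n - i ≤ (j : ℕ)) hj hja)
    push Not at hbig
    have hle : ∀ j : Fin n, (Finsupp.single q 1 + a : Fin n →₀ ℕ) j ≠ 0 → j ≤ p := by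
      intro j hj
      by_contra hjp
      rw [hp, Fin.le_def] at hjp
      exact hj (hbig j (by simp only at hjp; omega))
    have hle' : ∀ j : Fin n, (Finsupp.single p 1 + a : Fin n →₀ ℕ) j ≠ 0 → j ≤ p := by
      intro j hj
      by_cases hjp : j = p
      · exact hjp.le
      · refine hle j fun h0 => hj ?_
        simp only [Finsupp.add_apply, Nat.add_eq_zero_iff] at h0 ⊢
        exact ⟨Finsupp.single_eq_of_ne hjp, h0.2⟩
    have hqp : q ≤ p := hle q (by simp)
    rcases hqp.eq_or_lt with rfl | hqp
    · exact ha
    rcases hmon.monomial_mem_sup hX ha with ha | ha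
    · refine Ideal.mem_sup_left ?_
      have := hstab _ ha p (by simp) hle' (by simp only [hp]; omega) q hqp
      rwa [add_assoc, add_tsub_cancel_left, add_comm] at this
    · exfalso
      obtain ⟨j, hj, hja⟩ := exists_ne_zero_of_monomial_mem_span_X ha
      have := hle' j hja
      rw [hp, Fin.le_def] at this
      simp only at this
      omega
  · rintro ⟨s, hs⟩
    refine ⟨s, ?_⟩
    rw [mul_comm]
    exact hs _ (Ideal.pow_mem_pow (Ideal.subset_span (Set.mem_range_self _)) s)
end

section
/- Let I be a weakly D-stable monomial ideal in P = k[x_1,…,x_n] with dim(P/I) = D. Then I is in Noether position; that is, for every index 1 ≤ j ≤ n−D there exists an exponent e_j ≥ 1 such that the pure power x_j^{e_j} lies in I. -/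
open MvPolynomial

/-- A monomial ideal `I` is weakly `ℓ`-stable: for every term `t ∈ I` (with exponent
vector `a` and maximal variable index `w = w(t)`) with `w(t) ≥ n - ℓ` (1-based indexing)
and every `i ≤ n - ℓ`, the term `x_i · t / x_{w(t)}` also lies in `I`. -/
def WeaklyLStable {k : Type*} [Field k] {n : ℕ} (ℓ : ℕ)
    (I : Ideal (MvPolynomial (Fin n) k)) : Prop :=
  ∀ a : Fin n →₀ ℕ, monomial a (1 : k) ∈ I →
    ∀ w : Fin n, a w ≠ 0 → (∀ j, a j ≠ 0 → j ≤ w) →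
      n - ℓ ≤ (w : ℕ) + 1 →
      ∀ i : Fin n, (i : ℕ) + 1 ≤ n - ℓ →
        monomial (a + Finsupp.single i 1 - Finsupp.single w 1) (1 : k) ∈ I

/-- A monomial involving a variable outside the range of `f` is killed by `killCompl`. -/
theorem killCompl_monomial_eq_zero {σ τ R : Type*} [CommSemiring R] {f : σ → τ}
    (hf : Function.Injective f) {a : τ →₀ ℕ} {i : τ} (hi : i ∉ Set.range f) (ha : a i ≠ 0)
    (r : R) : killCompl hf (monomial a r) = 0 := by
  rw [killCompl, aeval_monomial, Finsupp.prod,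
    Finset.prod_eq_zero (Finsupp.mem_support_iff.mpr ha) (by simp [dif_neg hi, ha]), mul_zero]

/-- If every term of a monomial ideal `I` involves a variable outside `T`, then the dimension
of the quotient by `I` is at least the cardinality of `T`. -/
theorem card_le_ringKrullDim_quotient_of_forall_monomial {k : Type*} [Field k] {n : ℕ}
    {I : Ideal (MvPolynomial (Fin n) k)} (hmon : IsMonomialIdeal I) (T : Finset (Fin n))
    (hT : ∀ a : Fin n →₀ ℕ, monomial a (1 : k) ∈ I → ∃ i ∉ T, a i ≠ 0) :
    (T.card : WithBot ℕ∞) ≤ ringKrullDim (MvPolynomial (Fin n) k ⧸ I) := by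
  have hinj : Function.Injective (Subtype.val : T → Fin n) := Subtype.val_injective
  let f : MvPolynomial (Fin n) k →+* MvPolynomial T k := (killCompl hinj).toRingHom
  have hf : Function.Surjective f := fun p => ⟨rename _ p, killCompl_rename_app hinj p⟩
  have hI : ∀ p ∈ I, f p = 0 := by
    suffices I ≤ RingHom.ker f from fun p hp => this hp
    obtain ⟨S, rfl⟩ := hmon
    rw [Ideal.span_le]
    rintro _ ⟨a, ha, rfl⟩
    obtain ⟨i, hiT, hi⟩ := hT a (Ideal.subset_span ⟨a, ha, rfl⟩)
    exact killCompl_monomial_eq_zero hinj (by simpa using hiT) hi 1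
  have h₁ := ringKrullDim_le_of_surjective _ (Ideal.Quotient.lift_surjective_of_surjective I hI hf)
  have h₂ := ringKrullDim_add_natCard_le_ringKrullDim_mvPolynomial (R := k) T
  rw [ringKrullDim_eq_zero_of_field, zero_add, Nat.card_eq_fintype_card, Fintype.card_coe] at h₂
  exact h₂.trans h₁

/-- In a weakly `ℓ`-stable ideal, a term in `x_j` (with `j ≤ n - ℓ`) and the last `ℓ` variables
can be moved to a pure power of `x_j`. -/
theorem WeaklyLStable.exists_monomial_single_mem {k : Type*} [Field k] {n ℓ : ℕ}
    {I : Ideal (MvPolynomial (Fin n) k)} (hstab : WeaklyLStable ℓ I) {j : Fin n}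
    (hj : (j : ℕ) + 1 ≤ n - ℓ) (a : Fin n →₀ ℕ) (ha : monomial a (1 : k) ∈ I)
    (hsupp : ∀ i, a i ≠ 0 → i = j ∨ n - ℓ ≤ (i : ℕ)) :
    ∃ e : ℕ, monomial (Finsupp.single j e) (1 : k) ∈ I := by
  induction hm : ∑ i ∈ Finset.univ.erase j, a i using Nat.strong_induction_on generalizing a with
  | _ m ih =>
  subst hm
  by_cases hpure : ∀ i, i ≠ j → a i = 0
  · refine ⟨a j, ?_⟩
    rwa [← (Finsupp.eq_single_iff (f := a)).mpr ⟨fun i hi => ?_, rfl⟩]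
    by_contra hij
    exact Finsupp.mem_support_iff.mp hi (hpure i (by simpa using hij))
  push Not at hpure
  obtain ⟨i, hij, hi⟩ := hpure
  obtain ⟨w, hw, hmax⟩ := a.support.exists_max_image id ⟨i, Finsupp.mem_support_iff.mpr hi⟩
  simp only [Finsupp.mem_support_iff, id] at hw hmax
  have hiw : (i : ℕ) ≤ w := hmax i hi
  have hni : n - ℓ ≤ (i : ℕ) := (hsupp i hi).resolve_left hij
  have hwj : w ≠ j := by
    rintro rfl
    omega
  have hb (c : Fin n) (hc : c ≠ j) :
      (a + Finsupp.single j 1 - Finsupp.single w 1 : Fin n →₀ ℕ) c = a c - Finsupp.single w 1 c := by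
    simp [Finsupp.single_eq_of_ne hc]
  refine ih _ ?_ _ (hstab a ha w hw hmax (by omega) j hj) (fun c hc => ?_) rfl
  · refine Finset.sum_lt_sum (fun c hc => ?_) ⟨w, by simp [hwj], ?_⟩
    · rw [hb c (Finset.ne_of_mem_erase hc)]
      exact Nat.sub_le _ _
    · rw [hb w hwj, Finsupp.single_eq_same]
      omega
  · by_cases hcj : c = j
    · exact Or.inl hcj
    · rw [hb c hcj] at hc
      exact hsupp c (by omega)

/-- A weakly `D`-stable monomial ideal with `dim (P/I) = D` is in Noether position:
for every `1 ≤ j ≤ n - D` (1-based indexing) some pure power `x_j^{e_j}` with `e_j ≥ 1`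
lies in `I`. -/
theorem noether_position_of_weaklyDStable
    {k : Type*} [Field k] {n D : ℕ} (hD : D < n)
    (I : Ideal (MvPolynomial (Fin n) k)) (hmon : IsMonomialIdeal I)
    (hdim : ringKrullDim (MvPolynomial (Fin n) k ⧸ I) = (D : WithBot (WithTop ℕ)))
    (hstab : WeaklyLStable D I) :
    ∀ j : Fin n, (j : ℕ) + 1 ≤ n - D → ∃ e : ℕ, 1 ≤ e ∧ X j ^ e ∈ I := by
  intro j hj
  have hT : ∃ a : Fin n →₀ ℕ, monomial a (1 : k) ∈ I ∧
      ∀ i, a i ≠ 0 → i = j ∨ n - D ≤ (i : ℕ) := by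
    by_contra! hcon
    let g : Fin (D + 1) → Fin n := Fin.cons j fun c => ⟨n - D + c, by omega⟩
    have hg : Function.Injective g := by
      refine Fin.cons_injective_iff.mpr ⟨?_, fun c d hcd => ?_⟩
      · rintro ⟨c, hc⟩
        have := congrArg Fin.val hc
        simp only at this
        omega
      · simp only [Fin.mk.injEq] at hcd
        omega
    have h := card_le_ringKrullDim_quotient_of_forall_monomial hmon
      (Finset.univ.map ⟨g, hg⟩) fun a ha => by
        obtain ⟨i, hi, hij, hin⟩ := hcon a ha
        refine ⟨i, fun hmem => ?_, hi⟩
        obtain ⟨c, -, rfl⟩ := Finset.mem_map.mp hmem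
        induction c using Fin.cases with
        | zero => exact hij rfl
        | succ c => exact absurd hin (by simp [g])
    rw [hdim, Finset.card_map, Finset.card_univ, Fintype.card_fin] at h
    exact D.lt_irrefl (Nat.cast_le (α := WithBot ℕ∞).mp h)
  obtain ⟨a, ha, hsupp⟩ := hT
  obtain ⟨e, he⟩ := hstab.exists_monomial_single_mem hj a ha hsupp
  refine ⟨e + 1, by omega, ?_⟩
  rw [pow_succ, X_pow_eq_monomial]
  exact I.mul_mem_right _ he
end

section
/- Let I be a weakly ℓ-stable monomial ideal in P = k[x_1,…,x_n] and let t = x_1^{α_1}···x_n^{α_n} ∈ I. Then for every tuple (β_1,…,β_{n−ℓ}) of non-negative integers with β_1 + ⋯ + β_{n−ℓ} = α_{n−ℓ+1} + ⋯ + α_n, the term x_1^{α_1+β_1} ··· x_{n−ℓ}^{α_{n−ℓ}+β_{n−ℓ}} is also contained in I. -/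
open MvPolynomial

/-- Let `I` be a weakly `ℓ`-stable monomial ideal and let `t = x_1^{α_1} ⋯ x_n^{α_n} ∈ I`
(exponent vector `a`).  Then for every tuple `(β_1, …, β_{n-ℓ})` of non-negative
integers (an exponent vector `b` vanishing on the last `ℓ` variables) with
`β_1 + ⋯ + β_{n-ℓ} = α_{n-ℓ+1} + ⋯ + α_n`, the term
`x_1^{α_1+β_1} ⋯ x_{n-ℓ}^{α_{n-ℓ}+β_{n-ℓ}}` (exponent vector `c`) also lies in `I`. -/
theorem weaklyLStable_term_closure
    {k : Type*} [Field k] {n ℓ : ℕ} (hℓ : ℓ < n)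
    (I : Ideal (MvPolynomial (Fin n) k)) (hmon : IsMonomialIdeal I)
    (hstab : WeaklyLStable ℓ I)
    (a : Fin n →₀ ℕ) (ha : monomial a (1 : k) ∈ I)
    (b : Fin n →₀ ℕ) (hb : ∀ i : Fin n, n - ℓ ≤ (i : ℕ) → b i = 0)
    (hsum : ∑ i, b i =
      ∑ i ∈ Finset.univ.filter (fun i : Fin n => n - ℓ ≤ (i : ℕ)), a i)
    (c : Fin n →₀ ℕ)
    (hc : ∀ i : Fin n, c i = if (i : ℕ) < n - ℓ then a i + b i else 0) :
    monomial c (1 : k) ∈ I := by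
  induction hN : ∑ i, b i generalizing a b with
  | zero =>
    rw [hN, eq_comm] at hsum
    have htail : ∀ i : Fin n, n - ℓ ≤ (i : ℕ) → a i = 0 := by
      simpa [Finset.sum_eq_zero_iff] using hsum
    have hzero : ∀ i, b i = 0 := by simpa [Finset.sum_eq_zero_iff] using hN
    have hca : c = a := by
      ext i
      rw [hc, hzero i]
      split_ifs with h
      · rfl
      · exact (htail i (not_lt.mp h)).symm
    rwa [hca]
  | succ N ih =>
    obtain ⟨i, -, hi⟩ := Finset.exists_ne_zero_of_sum_ne_zero (hN.trans_ne N.succ_ne_zero)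
    obtain ⟨j, hj, haj⟩ := Finset.exists_ne_zero_of_sum_ne_zero
      ((hsum.symm.trans hN).trans_ne N.succ_ne_zero)
    have hj' : n - ℓ ≤ (j : ℕ) := (Finset.mem_filter.mp hj).2
    have hi' : (i : ℕ) < n - ℓ := lt_of_not_ge fun h => hi (hb i h)
    obtain ⟨w, hw, hmax⟩ := a.support.exists_max_image id ⟨j, Finsupp.mem_support_iff.mpr haj⟩
    rw [Finsupp.mem_support_iff] at hw
    have hmax' : ∀ m, a m ≠ 0 → m ≤ w := fun m hm => hmax m (Finsupp.mem_support_iff.mpr hm)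
    have hw' : n - ℓ ≤ (w : ℕ) := hj'.trans (hmax' j haj)
    have hmem := hstab a ha w hw hmax' (by omega) i hi'
    obtain ⟨d, rfl⟩ : ∃ d, a = d + Finsupp.single w 1 :=
      ⟨a - Finsupp.single w 1, (tsub_add_cancel_of_le
        (Finsupp.single_le_iff.mpr (Nat.one_le_iff_ne_zero.mpr hw))).symm⟩
    obtain ⟨e, rfl⟩ : ∃ e, b = e + Finsupp.single i 1 :=
      ⟨b - Finsupp.single i 1, (tsub_add_cancel_of_le
        (Finsupp.single_le_iff.mpr (Nat.one_le_iff_ne_zero.mpr hi))).symm⟩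
    rw [add_right_comm, add_tsub_cancel_right] at hmem
    simp only [Finsupp.add_apply, Finset.sum_add_distrib, Finsupp.single_apply,
      Finset.sum_ite_eq, Finset.mem_univ, Finset.mem_filter, true_and, if_true, hw'] at hsum hN
    refine ih (d + Finsupp.single i 1) hmem e (fun m hm => ?_) ?_ (fun m => ?_) (by omega)
    · exact (Nat.add_eq_zero_iff.mp (hb m hm)).1
    · simp only [Finsupp.add_apply, Finset.sum_add_distrib, Finsupp.single_apply,
        Finset.sum_ite_eq, Finset.mem_filter, Finset.mem_univ, true_and,
        if_neg (not_le.mpr hi')]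
      omega
    · rw [hc]
      split_ifs with hm
      · have hwm : w ≠ m := by rintro rfl; omega
        simp only [Finsupp.add_apply, Finsupp.single_eq_of_ne' hwm]
        ring
      · rfl
end

section
/- Let I be a weakly ℓ-stable monomial ideal in P = k[x_1,…,x_n] and let φ : P → P be the k-algebra endomorphism defined by φ(x_j) = x_j for 1 ≤ j ≤ n−ℓ and φ(x_{n−ℓ+i}) = −(a_{i,1}x_1 + ⋯ + a_{i,n−ℓ}x_{n−ℓ}) for 1 ≤ i ≤ ℓ, where the a_{i,j} ∈ k are arbitrary scalars. Then φ maps I into itself: φ(f) ∈ I for every f ∈ I. -/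
open MvPolynomial

/-- An algebra endomorphism fixing the first `n - ℓ` variables and sending every other variable to
a linear form in them maps each term of a weakly `ℓ`-stable ideal into that ideal. -/
theorem WeaklyLStable.map_monomial_mem {k : Type*} [Field k] {n ℓ : ℕ}
    {I : Ideal (MvPolynomial (Fin n) k)} (hstab : WeaklyLStable ℓ I) (coeff : Fin n → Fin n → k)
    (φ : MvPolynomial (Fin n) k →ₐ[k] MvPolynomial (Fin n) k)
    (hlow : ∀ j : Fin n, (j : ℕ) + 1 ≤ n - ℓ → φ (X j) = X j)
    (hhigh : ∀ j : Fin n, ¬ (j : ℕ) + 1 ≤ n - ℓ →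
      φ (X j) = - ∑ m ∈ Finset.univ.filter (fun m : Fin n => (m : ℕ) + 1 ≤ n - ℓ),
        C (coeff j m) * X m)
    (a : Fin n →₀ ℕ) (ha : monomial a (1 : k) ∈ I) : φ (monomial a 1) ∈ I := by
  induction hd : ∑ j ∈ Finset.univ.filter (fun j : Fin n => ¬ (j : ℕ) + 1 ≤ n - ℓ), a j
    generalizing a with
  | zero =>
    have hzero : ∀ j : Fin n, ¬ (j : ℕ) + 1 ≤ n - ℓ → a j = 0 := by
      simpa [Finset.sum_eq_zero_iff] using hd
    have hfix : φ (monomial a 1) = monomial a 1 := by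
      simp only [monomial_eq, map_mul, map_one, Finsupp.prod, map_prod, map_pow]
      congr 1
      refine Finset.prod_congr rfl fun j hj => ?_
      rw [hlow j (by_contra fun h => Finsupp.mem_support_iff.mp hj (hzero j h))]
    rwa [hfix]
  | succ d ih =>
    obtain ⟨j, hj, hja⟩ := Finset.exists_ne_zero_of_sum_ne_zero (hd.trans_ne d.succ_ne_zero)
    have hj' := (Finset.mem_filter.mp hj).2
    have hjs : j ∈ a.support := Finsupp.mem_support_iff.mpr hja
    obtain ⟨w, hw, hmax⟩ := a.support.exists_max_image id ⟨j, hjs⟩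
    have hjw : (j : ℕ) ≤ w := hmax j hjs
    have hwhigh : ¬ (w : ℕ) + 1 ≤ n - ℓ := by omega
    have hwa : a w ≠ 0 := Finsupp.mem_support_iff.mp hw
    obtain ⟨b, rfl⟩ : ∃ b, a = b + Finsupp.single w 1 :=
      ⟨a - Finsupp.single w 1, (tsub_add_cancel_of_le (by
        simpa [Nat.one_le_iff_ne_zero] using hwa)).symm⟩
    have hbd : ∑ j ∈ Finset.univ.filter (fun j : Fin n => ¬ (j : ℕ) + 1 ≤ n - ℓ), b j = d := by
      simp only [Finsupp.add_apply, Finset.sum_add_distrib, Finsupp.single_apply,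
        Finset.sum_ite_eq, Finset.mem_filter, Finset.mem_univ, true_and, if_pos hwhigh] at hd
      omega
    have hmem : ∀ m : Fin n, (m : ℕ) + 1 ≤ n - ℓ →
        φ (monomial (b + Finsupp.single m 1) 1) ∈ I := by
      intro m hm
      refine ih _ ?_ ?_
      · have := hstab _ ha w hwa (fun i hi => hmax i (Finsupp.mem_support_iff.mpr hi))
          (by omega) m hm
        rwa [add_right_comm, add_tsub_cancel_right] at this
      · simp only [Finsupp.add_apply, Finset.sum_add_distrib, Finsupp.single_apply,
          Finset.sum_ite_eq, Finset.mem_filter, Finset.mem_univ, true_and, if_neg (not_not.mpr hm)]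
        exact hbd
    have hsplit : ∀ m : Fin n, φ (monomial (b + Finsupp.single m 1) 1) =
        φ (monomial b 1) * φ (X m) := by
      intro m
      rw [← map_mul, X, monomial_mul, one_mul]
    rw [hsplit, hhigh w hwhigh, mul_neg, Finset.mul_sum]
    refine I.neg_mem (I.sum_mem fun m hm => ?_)
    have hm' := (Finset.mem_filter.mp hm).2
    have := hmem m hm'
    rw [hsplit, hlow m hm'] at this
    rw [mul_left_comm]
    exact I.mul_mem_left _ this

/-- Let `I` be a weakly `ℓ`-stable monomial ideal and let `φ : P → P` be the `k`-algebra
endomorphism with `φ(x_j) = x_j` for `1 ≤ j ≤ n - ℓ` and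
`φ(x_{n-ℓ+i}) = -(a_{i,1} x_1 + ⋯ + a_{i,n-ℓ} x_{n-ℓ})` for `1 ≤ i ≤ ℓ`, with arbitrary
scalars `a_{i,j} ∈ k` (here the coefficient family is indexed by the substituted
variable, `coeff j m` being the coefficient of `x_m` in the image of `x_j`).
Then `φ` maps `I` into itself. -/
theorem weaklyLStable_substitution_closure
    {k : Type*} [Field k] {n ℓ : ℕ} (hℓ : ℓ < n)
    (I : Ideal (MvPolynomial (Fin n) k)) (hmon : IsMonomialIdeal I)
    (hstab : WeaklyLStable ℓ I)
    (coeff : Fin n → Fin n → k)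
    (φ : MvPolynomial (Fin n) k →ₐ[k] MvPolynomial (Fin n) k)
    (hφ : φ = aeval fun j : Fin n =>
      if (j : ℕ) + 1 ≤ n - ℓ then X j
      else - ∑ m ∈ Finset.univ.filter (fun m : Fin n => (m : ℕ) + 1 ≤ n - ℓ),
        C (coeff j m) * X m) :
    ∀ f ∈ I, φ f ∈ I := by
  obtain ⟨S, hS⟩ := hmon
  suffices h : I ≤ I.comap φ from fun f hf => h hf
  conv_lhs => rw [hS]
  rw [Ideal.span_le]
  rintro _ ⟨a, ha, rfl⟩
  refine hstab.map_monomial_mem coeff φ (fun j hj => ?_) (fun j hj => ?_) a ?_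
  · rw [hφ, aeval_X, if_pos hj]
  · rw [hφ, aeval_X, if_neg hj]
  · rw [hS]
    exact Ideal.subset_span ⟨a, ha, rfl⟩
end

section
/- Let I be a weakly D-stable monomial ideal in P = k[x_1,…,x_n] with dim(P/I) = D. Then I has a minimal generator of the form x_{n−D}^α; that is, there exists an integer α ≥ 1 with x_{n−D}^α ∈ I and x_{n−D}^{α−1} ∉ I. -/
open MvPolynomial

/-- In a weakly `ℓ`-stable ideal, a term in the variables of index at least `n - ℓ` (counted
from one) can be turned into a power of the first of these variables. -/
theorem WeaklyLStable.monomial_single_degree_mem {k : Type*} [Field k] {n ℓ : ℕ}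
    {I : Ideal (MvPolynomial (Fin n) k)} (hstab : WeaklyLStable ℓ I) {i : Fin n}
    (hi : (i : ℕ) + 1 = n - ℓ) {a : Fin n →₀ ℕ} (ha : monomial a (1 : k) ∈ I)
    (hle : ∀ j, a j ≠ 0 → i ≤ j) : monomial (Finsupp.single i a.degree) (1 : k) ∈ I := by
  induction hm : a.degree - a i using Nat.strong_induction_on generalizing a with
  | _ m ih =>
    by_cases hsupp : ∀ j, a j ≠ 0 → j = i
    · have hs : a = Finsupp.single i (a i) := by
        ext j
        by_cases hj : j = i
        · simp [hj]
        · rw [Finsupp.single_eq_of_ne hj]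
          by_contra h
          exact hj (hsupp j h)
      have hdeg : a.degree = a i := by
        conv_lhs => rw [hs, Finsupp.degree_single]
      rwa [hdeg, ← hs]
    · push Not at hsupp
      obtain ⟨j₀, hj₀, hne⟩ := hsupp
      have hnonempty : a.support.Nonempty := ⟨j₀, by simpa using hj₀⟩
      obtain ⟨w, hw, hmax⟩ := a.support.exists_max_image id hnonempty
      have hwa : a w ≠ 0 := by simpa using hw
      have hmax' : ∀ j, a j ≠ 0 → j ≤ w := fun j hj => hmax j (by simpa using hj)
      have hiw : i < w :=
        lt_of_lt_of_le (lt_of_le_of_ne (hle j₀ hj₀) (Ne.symm hne)) (hmax' j₀ hj₀)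
      have hmem := hstab a ha w hwa hmax' (by have := Fin.lt_def.mp hiw; omega) i hi.le
      set b := a + Finsupp.single i 1 - Finsupp.single w 1 with hb
      have hbw : b + Finsupp.single w 1 = a + Finsupp.single i 1 := by
        apply tsub_add_cancel_of_le
        rw [Finsupp.single_le_iff, Finsupp.add_apply]
        omega
      have hbdeg : b.degree = a.degree := by
        simpa using congrArg Finsupp.degree hbw
      have hbi : b i = a i + 1 := by
        simpa [Finsupp.single_eq_of_ne hiw.ne] using DFunLike.congr_fun hbw i
      have hble : ∀ j, b j ≠ 0 → i ≤ j := by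
        intro j hj
        by_contra hij
        have hji : j ≠ i := fun h => hij h.ge
        have hjw : j ≠ w := fun h => hij (h ▸ hiw.le)
        have hjb : b j = a j := by
          simpa [Finsupp.single_eq_of_ne hji, Finsupp.single_eq_of_ne hjw]
            using DFunLike.congr_fun hbw j
        exact hij (hle j (hjb ▸ hj))
      have hlt : a i + 1 ≤ a.degree := by
        rw [← hbdeg, ← hbi]
        exact Finsupp.le_degree i b
      rw [← hbdeg]
      exact ih _ (by omega) hmem hble rfl

/-- A monomial ideal containing no term supported on `s` has a quotient of Krull dimension at
least the cardinality of `s`. -/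
theorem IsMonomialIdeal.natCard_le_ringKrullDim_quotient {k : Type*} [Field k] {n : ℕ}
    {I : Ideal (MvPolynomial (Fin n) k)} (hmon : IsMonomialIdeal I) (s : Set (Fin n))
    (hs : ∀ a : Fin n →₀ ℕ, (∀ j, a j ≠ 0 → j ∈ s) → monomial a (1 : k) ∉ I) :
    (Nat.card s : WithBot ℕ∞) ≤ ringKrullDim (MvPolynomial (Fin n) k ⧸ I) := by
  classical
  obtain ⟨S, hS⟩ := hmon
  obtain ⟨f, hf⟩ : ∃ f : MvPolynomial (Fin n) k →ₐ[k] MvPolynomial s k,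
      f = aeval fun j => if h : j ∈ s then X ⟨j, h⟩ else 0 := ⟨_, rfl⟩
  have hfsurj : Function.Surjective f := by
    intro p
    refine ⟨rename Subtype.val p, ?_⟩
    have hcomp : f.comp (rename Subtype.val) = AlgHom.id k (MvPolynomial s k) := by
      ext j
      simp [hf]
    exact DFunLike.congr_fun hcomp p
  have hker : ∀ p ∈ I, f p = 0 := by
    suffices I ≤ RingHom.ker f from fun p hp => this hp
    conv_lhs => rw [hS]
    rw [Ideal.span_le]
    rintro _ ⟨a, haS, rfl⟩
    have haI : monomial a (1 : k) ∈ I := hS ▸ Ideal.subset_span ⟨a, haS, rfl⟩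
    obtain ⟨j, hj, hjs⟩ : ∃ j, a j ≠ 0 ∧ j ∉ s := by
      by_contra! h
      exact hs a h haI
    rw [SetLike.mem_coe, RingHom.mem_ker]
    simp only [hf, aeval_monomial]
    rw [Finsupp.prod, Finset.prod_eq_zero (i := j) (by simpa using hj) (by simp [hjs, hj]),
      mul_zero]
  have hle : ringKrullDim (MvPolynomial s k) ≤ ringKrullDim (MvPolynomial (Fin n) k ⧸ I) :=
    ringKrullDim_le_of_surjective (Ideal.Quotient.lift I (f : _ →+* _) hker)
      (Ideal.Quotient.lift_surjective_of_surjective I hker hfsurj)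
  rwa [MvPolynomial.ringKrullDim_of_isNoetherianRing, ringKrullDim_eq_zero_of_field, zero_add]
    at hle

/-- A weakly `D`-stable monomial ideal with `dim (P/I) = D` has a minimal generator of
the form `x_{n-D}^α`: there is an `α ≥ 1` with `x_{n-D}^α ∈ I` and `x_{n-D}^{α-1} ∉ I`.
(The variable `x_{n-D}` has `Fin n`-index `n - D - 1`.) -/
theorem weaklyDStable_minimal_pure_power
    {k : Type*} [Field k] {n D : ℕ} (hD : D < n)
    (I : Ideal (MvPolynomial (Fin n) k)) (hmon : IsMonomialIdeal I)
    (hdim : ringKrullDim (MvPolynomial (Fin n) k ⧸ I) = (D : WithBot (WithTop ℕ)))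
    (hstab : WeaklyLStable D I) :
    ∃ α : ℕ, 1 ≤ α ∧ X (⟨n - D - 1, by omega⟩ : Fin n) ^ α ∈ I ∧
      X (⟨n - D - 1, by omega⟩ : Fin n) ^ (α - 1) ∉ I := by
  classical
  set i : Fin n := ⟨n - D - 1, by omega⟩ with hi
  obtain ⟨a, ha, haI⟩ : ∃ a : Fin n →₀ ℕ, (∀ j, a j ≠ 0 → j ∈ Set.Ici i) ∧
      monomial a (1 : k) ∈ I := by
    by_contra! h
    have hle := hmon.natCard_le_ringKrullDim_quotient (Set.Ici i) h
    have hcard : Nat.card (Set.Ici i) = D + 1 := by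
      rw [Nat.card_coe_set_eq, ← Finset.coe_Ici, Set.ncard_coe_finset, Fin.card_Ici]
      simp only [hi]
      omega
    rw [hcard, hdim] at hle
    have hle' : ((D + 1 : ℕ) : ℕ∞) ≤ (D : ℕ∞) := WithBot.coe_le_coe.mp hle
    have : D + 1 ≤ D := by exact_mod_cast hle'
    omega
  have hex : ∃ α, X i ^ α ∈ I := ⟨a.degree, by
    rw [X_pow_eq_monomial]
    exact hstab.monomial_single_degree_mem (by simp only [hi]; omega) haI ha⟩
  have hpos : 1 ≤ Nat.find hex := by
    rw [Nat.one_le_iff_ne_zero]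
    intro h0
    have h1 : (1 : MvPolynomial (Fin n) k) ∈ I := by
      simpa [h0] using Nat.find_spec hex
    have : Subsingleton (MvPolynomial (Fin n) k ⧸ I) :=
      Ideal.Quotient.subsingleton_iff.mpr ((Ideal.eq_top_iff_one I).mpr h1)
    rw [ringKrullDim_eq_bot_of_subsingleton] at hdim
    exact WithBot.bot_ne_coe hdim
  exact ⟨Nat.find hex, hpos, Nat.find_spec hex, Nat.find_min hex (by omega)⟩
end

section
/- Let I be a weakly D-stable monomial ideal in P = k[x_1,…,x_n] with dim(P/I) = D, and let α ≥ 1 be the integer with x_{n−D}^α ∈ I and x_{n−D}^{α−1} ∉ I. Set J₂ = I + ⟨x_{n−D+1},…,x_n⟩. Then the largest degree d such that the homogeneous component (P/J₂)_d is nonzero equals α − 1; equivalently, every monomial of degree α in x_1,…,x_{n−D} lies in I, while not every monomial of degree α − 1 in x_1,…,x_{n−D} lies in I. -/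
open MvPolynomial

/-- The degree-`d` homogeneous component of the graded quotient ring `P/J` (for a
homogeneous ideal `J`), realised as the image of the space of homogeneous polynomials
of degree `d` under the quotient map. -/
noncomputable def quotComponent {k : Type*} [Field k] {n : ℕ}
    (J : Ideal (MvPolynomial (Fin n) k)) (d : ℕ) :
    Submodule k (MvPolynomial (Fin n) k ⧸ J) :=
  (homogeneousSubmodule (Fin n) k d).map (Ideal.Quotient.mkₐ k J).toLinearMap

/-- A weakly `ℓ`-stable ideal containing `x_m ^ d`, where `m + 1 = n - ℓ`, contains every term of
degree `d` in the variables of index at most `m`. -/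
theorem WeaklyLStable.monomial_mem_of_X_pow_mem {k : Type*} [Field k] {n ℓ : ℕ}
    {I : Ideal (MvPolynomial (Fin n) k)} (hI : WeaklyLStable ℓ I) {m : Fin n}
    (hm : (m : ℕ) + 1 = n - ℓ) {d : ℕ} (hd : X m ^ d ∈ I) (a : Fin n →₀ ℕ)
    (ha : ∀ j, a j ≠ 0 → j ≤ m) (hdeg : a.degree = d) : monomial a (1 : k) ∈ I := by
  obtain ⟨r, hr⟩ : ∃ r, r = (a.erase m).degree := ⟨_, rfl⟩
  induction r generalizing a with
  | zero =>
    have h0 : a.erase m = 0 := (Finsupp.degree_eq_zero_iff _).1 hr.symm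
    have hs : a = Finsupp.single m (a m) := by
      have := Finsupp.single_add_erase m a
      rw [h0, add_zero] at this
      exact this.symm
    rw [hs, Finsupp.degree_single] at hdeg
    rw [X_pow_eq_monomial, ← hdeg, ← hs] at hd
    exact hd
  | succ r ih =>
    obtain ⟨i, hi⟩ : ∃ i, a.erase m i ≠ 0 := by
      by_contra! h
      have h0 : a.erase m = 0 := Finsupp.ext h
      simp [h0] at hr
    have him : i ≠ m := by
      rintro rfl
      simp at hi
    rw [Finsupp.erase_ne him] at hi
    obtain ⟨c, rfl⟩ : ∃ c, a = c + Finsupp.single i 1 :=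
      ⟨a - Finsupp.single i 1, (tsub_add_cancel_of_le (by simpa using Nat.one_le_iff_ne_zero.2 hi)).symm⟩
    have hile : i ≤ m := ha i hi
    have hc : ∀ j, (c + Finsupp.single m 1 : Fin n →₀ ℕ) j ≠ 0 → j ≤ m := by
      intro j hj
      by_cases hjm : j = m
      · exact hjm.le
      · refine ha j fun h0 => hj ?_
        simp only [Finsupp.add_apply, Finsupp.single_apply, Ne.symm hjm, if_false] at h0 ⊢
        omega
    have hmem := ih (c + Finsupp.single m 1) hc (by simpa using hdeg) (by
      rw [Finsupp.erase_add, Finsupp.erase_single_ne him.symm] at hr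
      simpa [Finsupp.erase_add] using hr)
    have := hI _ hmem m (by simp) hc hm.ge i (by omega)
    rwa [add_right_comm, add_tsub_cancel_right] at this

/-- A term outside a monomial ideal `I`, not divisible by any of the variables in `T`, lies outside
the ideal generated by `I` and these variables. -/
theorem IsMonomialIdeal.monomial_notMem_sup {k : Type*} [Field k] {n : ℕ}
    {I : Ideal (MvPolynomial (Fin n) k)} (hI : IsMonomialIdeal I) {a : Fin n →₀ ℕ}
    (ha : monomial a (1 : k) ∉ I) {T : Set (Fin n)} (hT : ∀ j ∈ T, a j = 0) :
    monomial a (1 : k) ∉ I ⊔ Ideal.span (X '' T) := by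
  obtain ⟨S, rfl⟩ := hI
  have hX : (X '' T : Set (MvPolynomial (Fin n) k)) =
      (fun b => monomial b (1 : k)) '' ((fun j => Finsupp.single j 1) '' T) := by
    rw [Set.image_image]
    rfl
  rw [mem_ideal_span_monomial_image] at ha
  rw [hX, ← Ideal.span_union, ← Set.image_union, mem_ideal_span_monomial_image]
  intro h
  refine ha fun b hb => ?_
  obtain ⟨s, hs | ⟨j, hj, rfl⟩, hle⟩ := h b hb
  · exact ⟨s, hs, hle⟩
  · have hba : b = a := by simpa [eq_comm] using hb
    have := hle j
    simp [hba, hT j hj] at this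

/-- A component of `P/J` vanishes if `J` contains all terms of the given degree. -/
theorem quotComponent_eq_bot {k : Type*} [Field k] {n : ℕ}
    {J : Ideal (MvPolynomial (Fin n) k)} {d : ℕ}
    (h : ∀ a : Fin n →₀ ℕ, a.degree = d → monomial a (1 : k) ∈ J) : quotComponent J d = ⊥ := by
  rw [quotComponent, eq_bot_iff, Submodule.map_le_iff_le_comap]
  intro p hp
  rw [mem_homogeneousSubmodule] at hp
  refine Ideal.Quotient.eq_zero_iff_mem.2 ?_
  rw [p.as_sum]
  refine J.sum_mem fun a ha => ?_
  rw [← mul_one (coeff a p), ← C_mul_monomial]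
  refine J.mul_mem_left _ (h a ?_)
  rw [Finsupp.degree_eq_weight_one]
  exact hp (mem_support_iff.1 ha)

/-- A component of `P/J` is nonzero if some term of the given degree lies outside `J`. -/
theorem quotComponent_ne_bot {k : Type*} [Field k] {n : ℕ}
    {J : Ideal (MvPolynomial (Fin n) k)} {a : Fin n →₀ ℕ}
    (h : monomial a (1 : k) ∉ J) : quotComponent J a.degree ≠ ⊥ := by
  refine (Submodule.ne_bot_iff _).2 ⟨_, Submodule.mem_map_of_mem
    ((mem_homogeneousSubmodule _ _).2 (isHomogeneous_monomial (1 : k) rfl)), ?_⟩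
  exact fun h0 => h (Ideal.Quotient.eq_zero_iff_mem.1 h0)

/-- Let `I` be a weakly `D`-stable monomial ideal with `dim (P/I) = D` and let `α ≥ 1`
satisfy `x_{n-D}^α ∈ I`, `x_{n-D}^{α-1} ∉ I`.  Set `J₂ = I + ⟨x_{n-D+1}, …, x_n⟩`.
Then the largest degree `d` with `(P/J₂)_d ≠ 0` equals `α - 1`: the component in degree
`α - 1` is nonzero and all components in degrees `> α - 1` vanish. -/
theorem top_degree_of_weaklyDStable
    {k : Type*} [Field k] {n D : ℕ} (hD : D < n)
    (I : Ideal (MvPolynomial (Fin n) k)) (hmon : IsMonomialIdeal I)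
    (hdim : ringKrullDim (MvPolynomial (Fin n) k ⧸ I) = (D : WithBot (WithTop ℕ)))
    (hstab : WeaklyLStable D I)
    (α : ℕ) (hα : 1 ≤ α)
    (hin : X (⟨n - D - 1, by omega⟩ : Fin n) ^ α ∈ I)
    (hnotin : X (⟨n - D - 1, by omega⟩ : Fin n) ^ (α - 1) ∉ I)
    (J₂ : Ideal (MvPolynomial (Fin n) k))
    (hJ₂ : J₂ = I ⊔ Ideal.span {g | ∃ j : Fin n, n - D ≤ (j : ℕ) ∧ g = X j}) :
    quotComponent J₂ (α - 1) ≠ ⊥ ∧ ∀ d : ℕ, α - 1 < d → quotComponent J₂ d = ⊥ := by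
  have hspan : {g : MvPolynomial (Fin n) k | ∃ j : Fin n, n - D ≤ (j : ℕ) ∧ g = X j} =
      X '' {j : Fin n | n - D ≤ (j : ℕ)} := by
    ext g
    simp [eq_comm]
  rw [hspan] at hJ₂
  subst hJ₂
  constructor
  · rw [X_pow_eq_monomial] at hnotin
    have := quotComponent_ne_bot (hmon.monomial_notMem_sup hnotin
      (T := {j : Fin n | n - D ≤ (j : ℕ)}) fun j hj => by
        refine Finsupp.single_eq_of_ne ?_
        rintro rfl
        simp only [Set.mem_ofPred_eq] at hj
        omega)
    rwa [Finsupp.degree_single] at this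
  · intro d hd
    refine quotComponent_eq_bot fun a ha => ?_
    by_cases h : ∃ j : Fin n, n - D ≤ (j : ℕ) ∧ a j ≠ 0
    · obtain ⟨j, hj, haj⟩ := h
      refine Ideal.mem_sup_right (Ideal.mem_of_dvd _ ?_ (Ideal.subset_span ⟨j, hj, rfl⟩))
      exact X_dvd_monomial.2 (Or.inr haj)
    · push Not at h
      refine Ideal.mem_sup_left (hstab.monomial_mem_of_X_pow_mem
        (m := ⟨n - D - 1, by omega⟩) (by simp only; omega)
        (I.pow_mem_of_pow_mem hin (by omega : α ≤ d)) a (fun j hj => ?_) ha)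
      have := mt (h j) hj
      rw [Fin.le_def]
      simp only
      omega
end

section
/- Let I be a weakly D-stable monomial ideal in P = k[x_1,…,x_n] with dim(P/I) = D. For arbitrary scalars a_{i,j} ∈ k (1 ≤ i ≤ D, 1 ≤ j ≤ n−D) set y_i = x_{n−D+i} + a_{i,1}x_1 + ⋯ + a_{i,n−D}x_{n−D}, and let J₁ = I + ⟨y_1,…,y_D⟩ and J₂ = I + ⟨x_{n−D+1},…,x_n⟩. Then for every degree d, the k-vector space dimensions of the homogeneous components agree: dim_k (P/J₁)_d = dim_k (P/J₂)_d; in particular the largest degree with nonzero component is the same for P/J₁ and P/J₂. -/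
open MvPolynomial

section Shear

variable {k : Type*} [Field k] {n : ℕ}

/-- The shear fixing the variables of index below `m` and sending every other `X i` to
`X i + ∑ j ∈ s, c i j * X j`. -/
noncomputable def shearHom (m : ℕ) (s : Finset (Fin n)) (c : Fin n → Fin n → k) :
    MvPolynomial (Fin n) k →ₐ[k] MvPolynomial (Fin n) k :=
  aeval fun i => if m ≤ (i : ℕ) then X i + ∑ j ∈ s, C (c i j) * X j else X i

variable {m : ℕ} (s : Finset (Fin n)) (c : Fin n → Fin n → k)

theorem shearHom_X_of_le {i : Fin n} (hi : m ≤ (i : ℕ)) :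
    shearHom m s c (X i) = X i + ∑ j ∈ s, C (c i j) * X j := by
  simp [shearHom, hi]

theorem shearHom_X_of_lt {i : Fin n} (hi : (i : ℕ) < m) : shearHom m s c (X i) = X i := by
  simp [shearHom, hi]

theorem shearHom_monomial_of_lt {a : Fin n →₀ ℕ} (ha : ∀ i, a i ≠ 0 → (i : ℕ) < m) :
    shearHom m s c (monomial a 1) = monomial a 1 := by
  rw [monomial_eq, C_1, one_mul, Finsupp.prod, map_prod]
  refine Finset.prod_congr rfl fun i hi => ?_
  rw [map_pow, shearHom_X_of_lt s c (ha i (Finsupp.mem_support_iff.mp hi))]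

theorem shearHom_isHomogeneous {p : MvPolynomial (Fin n) k} {d : ℕ} (hp : p.IsHomogeneous d) :
    (shearHom m s c p).IsHomogeneous d := by
  rw [← one_mul d]
  refine hp.aeval _ fun i => ?_
  split_ifs
  · exact (isHomogeneous_X k i).add
      (IsHomogeneous.sum _ _ _ fun j _ => isHomogeneous_C_mul_X (c i j) j)
  · exact isHomogeneous_X k i

theorem shearHom_comp_shearHom_neg (hs : ∀ j ∈ s, (j : ℕ) < m) :
    (shearHom m s c).comp (shearHom m s (-c)) = AlgHom.id k _ := by
  refine algHom_ext fun i => ?_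
  rw [AlgHom.comp_apply, AlgHom.id_apply]
  rcases lt_or_ge (i : ℕ) m with hi | hi
  · rw [shearHom_X_of_lt _ _ hi, shearHom_X_of_lt _ _ hi]
  · have h : ∀ j ∈ s, shearHom m s c (C ((-c) i j) * X j) = -(C (c i j) * X j) := by
      intro j hj
      rw [map_mul, shearHom_X_of_lt _ _ (hs j hj), ← algebraMap_eq, AlgHom.commutes]
      simp
    rw [shearHom_X_of_le _ _ hi, map_add, shearHom_X_of_le _ _ hi, map_sum,
      Finset.sum_congr rfl h, Finset.sum_neg_distrib, add_neg_cancel_right]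

/-- `shearHom` as an automorphism; its inverse negates the coefficients. -/
noncomputable def shearEquiv (m : ℕ) (s : Finset (Fin n)) (hs : ∀ j ∈ s, (j : ℕ) < m)
    (c : Fin n → Fin n → k) : MvPolynomial (Fin n) k ≃ₐ[k] MvPolynomial (Fin n) k :=
  AlgEquiv.ofAlgHom (shearHom m s c) (shearHom m s (-c)) (shearHom_comp_shearHom_neg s c hs)
    (by simpa using shearHom_comp_shearHom_neg s (-c) hs)

theorem monomial_eq_X_mul {a : Fin n →₀ ℕ} {w : Fin n} (haw : a w ≠ 0) :
    monomial a (1 : k) = X w * monomial (a - Finsupp.single w 1) 1 := by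
  have h : Finsupp.single w 1 ≤ a := by
    rw [Finsupp.single_le_iff]
    omega
  rw [X, monomial_mul, one_mul, add_tsub_cancel_of_le h]

/-- A term of `I` lies in the image under the shear of any ideal `J ⊇ I` containing the variables
of index at least `m`, provided the terms of `I` admit exchanging their last variable, when it has
index at least `m`, for any variable in `s`. -/
theorem monomial_mem_map_shearHom (hs : ∀ j ∈ s, (j : ℕ) < m)
    {I J : Ideal (MvPolynomial (Fin n) k)} (hIJ : I ≤ J) (hX : ∀ j : Fin n, m ≤ (j : ℕ) → X j ∈ J)
    (hstab : ∀ a : Fin n →₀ ℕ, monomial a (1 : k) ∈ I → ∀ w : Fin n, a w ≠ 0 →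
      (∀ j, a j ≠ 0 → j ≤ w) → m ≤ (w : ℕ) → ∀ i ∈ s,
        monomial (a + Finsupp.single i 1 - Finsupp.single w 1) (1 : k) ∈ I)
    (a : Fin n →₀ ℕ) (ha : monomial a (1 : k) ∈ I) :
    monomial a (1 : k) ∈ J.map (shearHom m s c) := by
  induction hN : ∑ i ∈ Finset.univ.filter (fun i : Fin n => m ≤ (i : ℕ)), a i
    using Nat.strong_induction_on generalizing a with
  | _ N ih =>
  by_cases h : ∀ i, a i ≠ 0 → (i : ℕ) < m
  · rw [← shearHom_monomial_of_lt s c h]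
    exact Ideal.mem_map_of_mem (shearHom m s c) (hIJ ha)
  · push Not at h
    obtain ⟨v, hav, hv⟩ := h
    have hne : a.support.Nonempty := ⟨v, Finsupp.mem_support_iff.mpr hav⟩
    set w := a.support.max' hne
    have haw : a w ≠ 0 := Finsupp.mem_support_iff.mp (a.support.max'_mem hne)
    have hmax : ∀ j, a j ≠ 0 → j ≤ w := fun j hj =>
      a.support.le_max' j (Finsupp.mem_support_iff.mpr hj)
    have hw : m ≤ (w : ℕ) := hv.trans (hmax v hav)
    have hy : X w + ∑ j ∈ s, C (c w j) * X j ∈ J.map (shearHom m s c) := by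
      rw [← shearHom_X_of_le s c hw]
      exact Ideal.mem_map_of_mem (shearHom m s c) (hX w hw)
    rw [monomial_eq_X_mul haw, ← add_sub_cancel_right (X w) (∑ j ∈ s, C (c w j) * X j),
      sub_mul, Finset.sum_mul]
    refine Ideal.sub_mem _ (Ideal.mul_mem_right _ _ hy) (Ideal.sum_mem _ fun j hj => ?_)
    have hsingle : Finsupp.single w 1 ≤ a := by
      rw [Finsupp.single_le_iff]
      omega
    have hmul : X j * monomial (a - Finsupp.single w 1) (1 : k) =
        monomial (a + Finsupp.single j 1 - Finsupp.single w 1) 1 := by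
      rw [X, monomial_mul, one_mul, add_comm, tsub_add_eq_add_tsub hsingle]
    rw [mul_assoc, hmul]
    refine Ideal.mul_mem_left _ _ (ih _ ?_ _ (hstab a ha w haw hmax hw j hj) rfl)
    rw [← hN]
    have hjlt := hs j hj
    refine Finset.sum_lt_sum (fun i hi => ?_) ⟨w, by simpa using hw, ?_⟩
    · have hji : j ≠ i := by
        rintro rfl
        exact absurd (Finset.mem_filter.mp hi).2 (by omega)
      simp [Finsupp.single_eq_of_ne' hji]
    · have hjw : j ≠ w := by
        rintro h
        rw [h] at hjlt
        omega
      simp only [Finsupp.tsub_apply, Finsupp.add_apply, Finsupp.single_eq_of_ne' hjw,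
        Finsupp.single_eq_same]
      omega

end Shear

/-- A degree-preserving automorphism carrying `J₂` onto `J₁` carries the homogeneous components of
`P/J₂` onto those of `P/J₁`. -/
theorem map_quotComponent {k : Type*} [Field k] {n : ℕ} {J₁ J₂ : Ideal (MvPolynomial (Fin n) k)}
    (e : MvPolynomial (Fin n) k ≃ₐ[k] MvPolynomial (Fin n) k)
    (he : J₁ = J₂.map (e : _ →+* _))
    (hom : ∀ p d, p.IsHomogeneous d → (e p).IsHomogeneous d)
    (hom_symm : ∀ p d, p.IsHomogeneous d → (e.symm p).IsHomogeneous d) (d : ℕ) :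
    (quotComponent J₂ d).map
      (Ideal.quotientEquivAlg J₂ J₁ e he).toLinearEquiv.toLinearMap = quotComponent J₁ d := by
  ext x
  simp only [quotComponent, Submodule.mem_map, mem_homogeneousSubmodule]
  constructor
  · rintro ⟨_, ⟨p, hp, rfl⟩, rfl⟩
    exact ⟨e p, hom p d hp, rfl⟩
  · rintro ⟨p, hp, rfl⟩
    refine ⟨_, ⟨e.symm p, hom_symm p d hp, rfl⟩, ?_⟩
    change Ideal.Quotient.mk J₁ (e (e.symm p)) = Ideal.Quotient.mk J₁ p
    rw [e.apply_symm_apply]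

/-- Let `I` be a weakly `D`-stable monomial ideal with `dim (P/I) = D`.  For arbitrary
scalars, set `y_i = x_{n-D+i} + a_{i,1} x_1 + ⋯ + a_{i,n-D} x_{n-D}` for `1 ≤ i ≤ D`
(the coefficient family being indexed by the leading variable `x_{n-D+i}`), and let
`J₁ = I + ⟨y_1, …, y_D⟩` and `J₂ = I + ⟨x_{n-D+1}, …, x_n⟩`.  Then for every degree `d`
the `k`-vector space dimensions of the homogeneous components agree:
`dim_k (P/J₁)_d = dim_k (P/J₂)_d`. -/
theorem components_dim_eq_of_weaklyDStable
    {k : Type*} [Field k] {n D : ℕ} (hD : D < n)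
    (I : Ideal (MvPolynomial (Fin n) k)) (hmon : IsMonomialIdeal I)
    (hdim : ringKrullDim (MvPolynomial (Fin n) k ⧸ I) = (D : WithBot (WithTop ℕ)))
    (hstab : WeaklyLStable D I)
    (coeff : Fin n → Fin n → k)
    (J₁ J₂ : Ideal (MvPolynomial (Fin n) k))
    (hJ₁ : J₁ = I ⊔ Ideal.span {g | ∃ i : Fin n, n - D ≤ (i : ℕ) ∧
      g = X i + ∑ j ∈ Finset.univ.filter (fun j : Fin n => (j : ℕ) + 1 ≤ n - D),
        C (coeff i j) * X j})
    (hJ₂ : J₂ = I ⊔ Ideal.span {g | ∃ j : Fin n, n - D ≤ (j : ℕ) ∧ g = X j}) :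
    ∀ d : ℕ, Module.finrank k (quotComponent J₁ d) =
      Module.finrank k (quotComponent J₂ d) := by
  have hlow : ∀ j ∈ Finset.univ.filter (fun j : Fin n => (j : ℕ) + 1 ≤ n - D), (j : ℕ) < n - D := by
    intro j hj
    have := (Finset.mem_filter.mp hj).2
    omega
  set s : Finset (Fin n) := Finset.univ.filter (fun j : Fin n => (j : ℕ) + 1 ≤ n - D)
  have key : J₁ = J₂.map (shearHom (n - D) s coeff) := by
    subst hJ₁ hJ₂
    obtain ⟨S, hS⟩ := hmon
    rw [Ideal.map_sup, Ideal.map_span]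
    apply le_antisymm
    · refine sup_le ?_ (le_sup_of_le_right ?_)
      · rw [← Ideal.map_span, ← Ideal.map_sup]
        conv_lhs => rw [hS]
        rw [Ideal.span_le]
        rintro _ ⟨a, ha, rfl⟩
        have hI : monomial a (1 : k) ∈ I := by
          rw [hS]
          exact Ideal.subset_span ⟨a, ha, rfl⟩
        refine monomial_mem_map_shearHom s coeff hlow le_sup_left ?_ ?_ a hI
        · intro j hj
          exact Ideal.mem_sup_right (Ideal.subset_span ⟨j, hj, rfl⟩)
        · intro a ha w haw hmax hw i hi
          exact hstab a ha w haw hmax (by omega) i (Finset.mem_filter.mp hi).2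
      · refine Ideal.span_le.mpr ?_
        rintro _ ⟨i, hi, rfl⟩
        refine Ideal.subset_span ⟨X i, ⟨i, hi, rfl⟩, ?_⟩
        exact shearHom_X_of_le s coeff hi
    · refine sup_le ?_ (le_sup_of_le_right ?_)
      · conv_lhs => rw [hS]
        rw [Ideal.map_span, Ideal.span_le]
        rintro _ ⟨_, ⟨a, ha, rfl⟩, rfl⟩
        have hI : monomial a (1 : k) ∈ I := by
          rw [hS]
          exact Ideal.subset_span ⟨a, ha, rfl⟩
        rw [SetLike.mem_coe]
        beta_reduce
        by_cases h : ∀ i, a i ≠ 0 → (i : ℕ) < n - D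
        · rw [shearHom_monomial_of_lt s coeff h]
          exact Ideal.mem_sup_left hI
        · push Not at h
          obtain ⟨w, haw, hw⟩ := h
          rw [monomial_eq_X_mul haw, map_mul, shearHom_X_of_le s coeff hw]
          exact Ideal.mul_mem_right _ _ (Ideal.mem_sup_right (Ideal.subset_span ⟨w, hw, rfl⟩))
      · refine Ideal.span_le.mpr ?_
        rintro _ ⟨_, ⟨i, hi, rfl⟩, rfl⟩
        exact Ideal.subset_span ⟨i, hi, shearHom_X_of_le s coeff hi⟩
  intro d
  have hmap := map_quotComponent (shearEquiv (n - D) s hlow coeff) key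
    (fun p e hp => shearHom_isHomogeneous s coeff hp)
    (fun p e hp => shearHom_isHomogeneous s (-coeff) hp) d
  rw [← hmap]
  exact LinearEquiv.finrank_map_eq _ _
end

section
/- Let I be a weakly D-stable monomial ideal in P = k[x_1,…,x_n] with dim(P/I) = D over an infinite field k, and let α ≥ 1 be the integer with x_{n−D}^α ∈ I and x_{n−D}^{α−1} ∉ I. Then for every minimal reduction J of I (that is, J = I + ⟨y_1,…,y_D⟩ with linear forms y_1,…,y_D ∈ P_1 such that P/J is a finite-dimensional k-vector space), the reduction number r_J(P/I), i.e. the largest degree d with (P/J)_d ≠ 0, equals α − 1. In particular the absolute reduction number r(P/I) equals α − 1. -/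
open MvPolynomial

section

variable {k : Type*} [Field k] {m D : ℕ}

/-- The `k`-algebra map killing the first `m` variables and keeping the last `D`. -/
noncomputable def projLast (k : Type*) [Field k] (m D : ℕ) :
    MvPolynomial (Fin (m + D)) k →ₐ[k] MvPolynomial (Fin D) k :=
  aeval (Fin.addCases (fun _ => 0) X)

@[simp] lemma projLast_castAdd (i : Fin m) : projLast k m D (X (Fin.castAdd D i)) = 0 := by
  simp [projLast]

@[simp] lemma projLast_natAdd (l : Fin D) : projLast k m D (X (Fin.natAdd m l)) = X l := by
  simp [projLast]

/-- The `k`-algebra endomorphism fixing the first `m` variables and sending the last `D`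
variables to the linear forms in the first `m` variables given by the rows of `g`. -/
noncomputable def substLast (g : Matrix (Fin D) (Fin m) k) :
    MvPolynomial (Fin (m + D)) k →ₐ[k] MvPolynomial (Fin (m + D)) k :=
  aeval (Fin.addCases (fun i => X (Fin.castAdd D i))
    (fun l => ∑ i, C (g l i) * X (Fin.castAdd D i)))

@[simp] lemma substLast_castAdd (g : Matrix (Fin D) (Fin m) k) (i : Fin m) :
    substLast g (X (Fin.castAdd D i)) = X (Fin.castAdd D i) := by
  simp [substLast]

@[simp] lemma substLast_natAdd (g : Matrix (Fin D) (Fin m) k) (l : Fin D) :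
    substLast g (X (Fin.natAdd m l)) = ∑ i, C (g l i) * X (Fin.castAdd D i) := by
  simp [substLast]

/-- If the first `m` variables are nilpotent modulo `I` and `P/I` has dimension `D`, then `I`
is contained in the ideal of the first `m` variables. -/
lemma projLast_eq_zero_of_mem {I : Ideal (MvPolynomial (Fin (m + D)) k)}
    (hdim : ringKrullDim (MvPolynomial (Fin (m + D)) k ⧸ I) = (D : WithBot (WithTop ℕ)))
    {α : ℕ} (hpow : ∀ i : Fin m, X (Fin.castAdd D i) ^ α ∈ I)
    {f : MvPolynomial (Fin (m + D)) k} (hf : f ∈ I) : projLast k m D f = 0 := by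
  by_contra hr
  set r := projLast k m D f
  have hsucc := ringKrullDim_quotient_succ_le_of_nonZeroDivisor (mem_nonZeroDivisors_of_ne_zero hr)
  rw [MvPolynomial.ringKrullDim_of_isNoetherianRing, ringKrullDim_eq_zero_of_field,
    zero_add, Nat.card_fin] at hsucc
  let q : MvPolynomial (Fin (m + D)) k →+* MvPolynomial (Fin D) k ⧸ Ideal.span {r} :=
    (Ideal.Quotient.mk (Ideal.span {r})).comp (projLast k m D : _ →+* _)
  have hproj : Function.Surjective (projLast k m D) := fun g =>
    ⟨rename (Fin.natAdd m) g, by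
      have : (projLast k m D).comp (rename (Fin.natAdd m)) = AlgHom.id k _ := by
        ext l; simp
      simpa using DFunLike.congr_fun this g⟩
  have hq : Function.Surjective q := Ideal.Quotient.mk_surjective.comp hproj
  have hle : ringKrullDim (MvPolynomial (Fin (m + D)) k ⧸ I) ≤
      ringKrullDim (MvPolynomial (Fin D) k ⧸ Ideal.span {r}) := by
    rw [← ringKrullDim_eq_of_ringEquiv (RingHom.quotientKerEquivOfSurjective hq),
      ringKrullDim_quotient, ringKrullDim_quotient]
    have hsub : PrimeSpectrum.zeroLocus (I : Set (MvPolynomial (Fin (m + D)) k)) ⊆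
        PrimeSpectrum.zeroLocus (RingHom.ker q : Set (MvPolynomial (Fin (m + D)) k)) := by
      intro p hp
      rw [PrimeSpectrum.mem_zeroLocus, SetLike.coe_subset_coe] at hp ⊢
      have hcongr : (Ideal.Quotient.mkₐ k p.asIdeal).comp
          ((rename (Fin.natAdd m)).comp (projLast k m D)) = Ideal.Quotient.mkₐ k p.asIdeal := by
        ext i
        refine Fin.addCases (fun i => ?_) (fun l => ?_) i
        · have : X (Fin.castAdd D i) ∈ p.asIdeal := p.2.mem_of_pow_mem _ (hp (hpow i))
          simpa using (Ideal.Quotient.eq_zero_iff_mem.mpr this).symm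
        · simp
      have hiff : ∀ g, rename (Fin.natAdd m) (projLast k m D g) ∈ p.asIdeal ↔ g ∈ p.asIdeal := by
        intro g
        rw [← Ideal.Quotient.eq_zero_iff_mem, ← Ideal.Quotient.eq_zero_iff_mem]
        exact Eq.congr_left (DFunLike.congr_fun hcongr g)
      intro g hg
      have hg' : projLast k m D g ∈ Ideal.span {r} := Ideal.Quotient.eq_zero_iff_mem.mp hg
      obtain ⟨c, hc⟩ := Ideal.mem_span_singleton'.mp hg'
      rw [← hiff, ← hc, map_mul]
      exact Ideal.mul_mem_left _ _ ((hiff f).mpr (hp hf))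
    exact Order.krullDim_le_of_strictMono (Set.inclusion hsub) fun _ _ h => h
  rw [hdim] at hle
  have hlt : (D : WithBot ℕ∞) + 1 ≤ D := (add_le_add_left hle 1).trans hsucc
  have h : ((D + 1 : ℕ) : WithBot ℕ∞) ≤ (D : ℕ) := by exact_mod_cast hlt
  exact absurd (Nat.cast_le.mp h) (by omega)

/-- If `D` linear forms cut `P/I` down to finite dimension and `I` lies in the ideal of the first
`m` variables, then the forms are independent in the last `D` variables. -/
lemma det_ne_zero_of_finiteDimensional {I : Ideal (MvPolynomial (Fin (m + D)) k)}
    (hI : ∀ f ∈ I, projLast k m D f = 0) (E : Matrix (Fin D) (Fin m) k)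
    (A : Matrix (Fin D) (Fin D) k) {y : Fin D → MvPolynomial (Fin (m + D)) k}
    (hy : ∀ j, y j = ∑ i, C (E j i) * X (Fin.castAdd D i) + ∑ l, C (A j l) * X (Fin.natAdd m l))
    (hfin : FiniteDimensional k
      (MvPolynomial (Fin (m + D)) k ⧸ (I ⊔ Ideal.span (Set.range y)))) : A.det ≠ 0 := by
  intro hdet
  obtain ⟨v, hv, hAv⟩ := Matrix.exists_mulVec_eq_zero_iff.mpr hdet
  obtain ⟨l, hl⟩ := Function.ne_iff.mp hv
  let ψ : MvPolynomial (Fin (m + D)) k →ₐ[k] Polynomial k :=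
    (aeval fun l => Polynomial.C (v l) * Polynomial.X).comp (projLast k m D)
  have hker : ∀ f ∈ I ⊔ Ideal.span (Set.range y), ψ f = 0 := by
    suffices I ⊔ Ideal.span (Set.range y) ≤ RingHom.ker ψ from fun f hf => this hf
    refine sup_le (fun f hf => ?_) (Ideal.span_le.mpr ?_)
    · simp [ψ, RingHom.mem_ker, hI f hf]
    · rintro _ ⟨j, rfl⟩
      have hj : ∑ l, A j l * v l = 0 := congrFun hAv j
      have : ψ (y j) = Polynomial.C (∑ l, A j l * v l) * Polynomial.X := by
        simp only [hy, map_add, map_sum, map_mul, ψ, AlgHom.comp_apply, projLast_castAdd,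
          projLast_natAdd, aeval_X, map_zero, mul_zero, Finset.sum_const_zero, zero_add,
          Finset.sum_mul]
        refine Finset.sum_congr rfl fun l _ => ?_
        rw [show (C (A j l) : MvPolynomial (Fin (m + D)) k) = algebraMap k _ (A j l) from rfl,
          AlgHom.commutes, AlgHom.commutes, mul_assoc]
        rfl
      simp [RingHom.mem_ker, this, hj]
  let ψ' := Ideal.Quotient.liftₐ _ ψ hker
  have hsurj : Function.Surjective ψ' := by
    intro p
    refine ⟨Ideal.Quotient.mk _ (Polynomial.aeval (C (v l)⁻¹ * X (Fin.natAdd m l)) p), ?_⟩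
    change ψ _ = p
    rw [← Polynomial.aeval_algHom_apply]
    have : ψ (C (v l)⁻¹ * X (Fin.natAdd m l)) = Polynomial.X := by
      rw [map_mul, show (C (v l)⁻¹ : MvPolynomial (Fin (m + D)) k) = algebraMap k _ (v l)⁻¹ from rfl,
        AlgHom.commutes, Polynomial.algebraMap_eq]
      simp only [ψ, AlgHom.comp_apply, projLast_natAdd, aeval_X]
      rw [← mul_assoc, ← Polynomial.C_mul, inv_mul_cancel₀ hl, Polynomial.C_1, one_mul]
    rw [this, Polynomial.aeval_X_left_apply]
  have := Module.Finite.of_surjective ψ'.toLinearMap hsurj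
  exact Polynomial.not_finite this

lemma exists_substLast (E : Matrix (Fin D) (Fin m) k)
    {A : Matrix (Fin D) (Fin D) k} (hA : A.det ≠ 0) {y : Fin D → MvPolynomial (Fin (m + D)) k}
    (hy : ∀ j, y j = ∑ i, C (E j i) * X (Fin.castAdd D i) + ∑ l, C (A j l) * X (Fin.natAdd m l)) :
    ∃ g : Matrix (Fin D) (Fin m) k, (∀ j, substLast g (y j) = 0) ∧
      ∀ f, f - substLast g f ∈ Ideal.span (Set.range y) := by
  have hu : IsUnit A.det := isUnit_iff_ne_zero.mpr hA
  set xE : Fin m → MvPolynomial (Fin (m + D)) k := fun i => X (Fin.castAdd D i) with hxE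
  set xL : Fin D → MvPolynomial (Fin (m + D)) k := fun l => X (Fin.natAdd m l) with hxL
  have hy' : y = (E.map C).mulVec xE + (A.map C).mulVec xL := funext hy
  let g := -(A⁻¹ * E)
  have hxg : (fun l => substLast g (xL l)) = (g.map C).mulVec xE := by
    funext l
    exact substLast_natAdd g l
  refine ⟨g, fun j => ?_, ?_⟩
  · have : (fun j => substLast g (y j)) =
        (E.map C).mulVec xE + (A.map C).mulVec (fun l => substLast g (xL l)) := by
      funext j
      simp only [hy, map_add, map_sum, map_mul, substLast_castAdd, Pi.add_apply, Matrix.mulVec,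
        dotProduct, Matrix.map_apply, hxE, hxL, algHom_C, algebraMap_eq]
    refine (congrFun this j).trans ?_
    rw [hxg, Matrix.mulVec_mulVec, ← Matrix.map_mul, ← Matrix.add_mulVec,
      show A * g = -E by simp [g, Matrix.mul_nonsing_inv_cancel_left _ _ hu]]
    simp [Matrix.mulVec, dotProduct]
  · have hx : xL - (g.map C).mulVec xE = (A⁻¹.map C).mulVec y := by
      rw [hy', Matrix.mulVec_add, Matrix.mulVec_mulVec, Matrix.mulVec_mulVec, ← Matrix.map_mul,
        ← Matrix.map_mul, Matrix.nonsing_inv_mul _ hu]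
      funext l
      simp [g, -Matrix.map_mul, Matrix.mulVec, dotProduct, Matrix.one_apply, sub_eq_add_neg, add_comm, apply_ite C]
    have hcomp : (Ideal.Quotient.mkₐ k (Ideal.span (Set.range y))).comp (substLast g) =
        Ideal.Quotient.mkₐ k (Ideal.span (Set.range y)) := by
      ext i
      refine Fin.addCases (fun i => ?_) (fun l => ?_) i
      · simp
      · refine (Ideal.Quotient.eq.mpr ?_).symm
        have : X (Fin.natAdd m l) - substLast g (X (Fin.natAdd m l)) =
            ∑ j, C (A⁻¹ l j) * y j := by
          rw [substLast_natAdd]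
          exact congrFun hx l
        change X (Fin.natAdd m l) - substLast g (X (Fin.natAdd m l)) ∈ _
        rw [this]
        exact Ideal.sum_mem _ fun j _ =>
          Ideal.mul_mem_left _ _ (Ideal.subset_span (Set.mem_range_self j))
    intro f
    exact Ideal.Quotient.eq.mp (DFunLike.congr_fun hcomp f).symm

/-- Let `p` be a property of exponent vectors preserved by replacing the largest variable,
when it is one of the last `D`, by any of the first `m`. If all terms in the first `m` variables
satisfying `p` are in `I`, then `substLast g` maps all terms satisfying `p` into `I`. -/
lemma substLast_monomial_mem {I : Ideal (MvPolynomial (Fin (m + D)) k)}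
    (g : Matrix (Fin D) (Fin m) k) {p : (Fin (m + D) →₀ ℕ) → Prop}
    (hstep : ∀ a, p a → ∀ l, a (Fin.natAdd m l) ≠ 0 → (∀ j, a j ≠ 0 → j ≤ Fin.natAdd m l) →
      ∀ i, p (a + Finsupp.single (Fin.castAdd D i) 1 - Finsupp.single (Fin.natAdd m l) 1))
    (hbase : ∀ a, p a → (∀ l, a (Fin.natAdd m l) = 0) → monomial a (1 : k) ∈ I)
    (a : Fin (m + D) →₀ ℕ) (ha : p a) : substLast g (monomial a 1) ∈ I := by
  induction hN : ∑ l, a (Fin.natAdd m l) using Nat.strong_induction_on generalizing a with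
  | _ N ih =>
  by_cases h0 : ∀ l, a (Fin.natAdd m l) = 0
  · have : substLast g (monomial a 1) = monomial a 1 := by
      rw [monomial_eq, Finsupp.prod_fintype _ _ (by simp), Fin.prod_univ_add]
      simp [h0]
    rw [this]
    exact hbase a ha h0
  · push Not at h0
    obtain ⟨l, hl, hmax⟩ := Finset.exists_max_image
      (Finset.univ.filter fun l => a (Fin.natAdd m l) ≠ 0) id
      (by obtain ⟨l, hl⟩ := h0; exact ⟨l, by simpa using hl⟩)
    have hl' : a (Fin.natAdd m l) ≠ 0 := by simpa using hl
    obtain ⟨b, rfl⟩ : ∃ b, a = b + Finsupp.single (Fin.natAdd m l) 1 :=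
      ⟨a - Finsupp.single (Fin.natAdd m l) 1, (tsub_add_cancel_of_le
        (Finsupp.single_le_iff.mpr (Nat.one_le_iff_ne_zero.mpr hl'))).symm⟩
    have hle : ∀ j, (b + Finsupp.single (Fin.natAdd m l) 1 : Fin (m + D) →₀ ℕ) j ≠ 0 → j ≤ Fin.natAdd m l := by
      intro j
      refine Fin.addCases (fun i _ => ?_) (fun l' h => ?_) j
      · rw [Fin.le_def, Fin.val_castAdd, Fin.val_natAdd]
        omega
      · exact (Fin.natAdd_le_natAdd_iff m).mpr (hmax l' (by simpa using h))
    have hmem : ∀ i, substLast g (monomial (b + Finsupp.single (Fin.castAdd D i) 1) 1) ∈ I := by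
      intro i
      have hp := hstep _ ha l hl' hle i
      rw [add_right_comm, add_tsub_cancel_right] at hp
      refine ih _ ?_ _ hp rfl
      rw [← hN]
      have hne : ∀ l', Fin.castAdd D i ≠ Fin.natAdd m l' := fun l' => by
        simp only [ne_eq, Fin.ext_iff, Fin.val_castAdd, Fin.val_natAdd]
        omega
      exact Finset.sum_lt_sum (fun l' _ => by simp [hne]) ⟨l, Finset.mem_univ _, by simp [hne]⟩
    have : substLast g (monomial (b + Finsupp.single (Fin.natAdd m l) 1) 1) =
        ∑ i, C (g l i) * substLast g (monomial (b + Finsupp.single (Fin.castAdd D i) 1) 1) := by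
      simp only [monomial_add_single, pow_one, map_mul, substLast_natAdd, substLast_castAdd,
        Finset.mul_sum]
      exact Finset.sum_congr rfl fun i _ => by ring
    rw [this]
    exact Ideal.sum_mem _ fun i _ => Ideal.mul_mem_left _ _ (hmem i)

lemma IsMonomialIdeal.monomial_mem {n : ℕ} {I : Ideal (MvPolynomial (Fin n) k)}
    (hI : IsMonomialIdeal I) {f : MvPolynomial (Fin n) k} (hf : f ∈ I) {a : Fin n →₀ ℕ}
    (ha : a ∈ f.support) : monomial a (1 : k) ∈ I := by
  obtain ⟨S, rfl⟩ := hI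
  obtain ⟨s, hs, hsa⟩ := mem_ideal_span_monomial_image.mp hf a ha
  refine mem_ideal_span_monomial_image.mpr fun b hb => ⟨s, hs, ?_⟩
  rw [Finset.mem_singleton.mp (support_monomial_subset hb)]
  exact hsa

lemma map_mem_of_monomial_mem {n : ℕ} {I : Ideal (MvPolynomial (Fin n) k)}
    (φ : MvPolynomial (Fin n) k →ₐ[k] MvPolynomial (Fin n) k) {f : MvPolynomial (Fin n) k}
    (h : ∀ a ∈ f.support, φ (monomial a 1) ∈ I) : φ f ∈ I := by
  rw [f.as_sum, map_sum]
  refine Ideal.sum_mem _ fun a ha => ?_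
  rw [show monomial a (coeff a f) = coeff a f • monomial a (1 : k) by simp [smul_monomial],
    map_smul]
  exact Submodule.smul_of_tower_mem I _ (h a ha)

/-- Weak stability and `x_m ^ α ∈ I` force all terms of degree at least `α` in the first `m`
variables to lie in `I`. -/
lemma WeaklyLStable.monomial_mem_of_le_degree
    {I : Ideal (MvPolynomial (Fin (m + 1 + D)) k)} (hstab : WeaklyLStable D I) {α : ℕ}
    (hin : X (Fin.castAdd D (Fin.last m)) ^ α ∈ I) (a : Fin (m + 1 + D) →₀ ℕ)
    (ha : ∀ l, a (Fin.natAdd (m + 1) l) = 0) (hdeg : α ≤ a.degree) :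
    monomial a (1 : k) ∈ I := by
  set e := Fin.castAdd D (Fin.last m) with he
  suffices ∀ N c, ∀ a : Fin (m + 1 + D) →₀ ℕ, (∀ l, a (Fin.natAdd (m + 1) l) = 0) →
      a.degree = N → α ≤ a.degree + c → monomial (a + Finsupp.single e c) (1 : k) ∈ I by
    simpa using this _ 0 a ha rfl (by simpa using hdeg)
  clear ha hdeg a
  intro N
  induction N with
  | zero =>
    intro c a _ hN hc
    rw [(Finsupp.degree_eq_zero_iff a).mp hN] at hc ⊢
    rw [zero_add, ← X_pow_eq_monomial]
    exact Ideal.pow_mem_of_pow_mem I hin (by simpa using hc)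
  | succ N ih =>
    intro c a ha hN hc
    have hne : a ≠ 0 := by rintro rfl; simp at hN
    obtain ⟨j, hj⟩ := Finsupp.ne_iff.mp hne
    obtain ⟨b, rfl⟩ : ∃ b, a = b + Finsupp.single j 1 :=
      ⟨a - Finsupp.single j 1, (tsub_add_cancel_of_le
        (Finsupp.single_le_iff.mpr (Nat.one_le_iff_ne_zero.mpr hj))).symm⟩
    have hdeg : (b + Finsupp.single j 1).degree = b.degree + 1 := by simp
    rw [hdeg] at hN hc
    have hb : ∀ l, b (Fin.natAdd (m + 1) l) = 0 := fun l => by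
      have := ha l
      simp only [Finsupp.add_apply] at this
      omega
    have hmem := ih (c + 1) b hb (by omega) (by omega)
    have hsmall : ∀ j' : Fin (m + 1 + D), (b + Finsupp.single j 1 : _ →₀ ℕ) j' ≠ 0 → (j' : ℕ) ≤ m := by
      intro j'
      refine Fin.addCases (fun i _ => ?_) (fun l h => absurd (ha l) h) j'
      rw [Fin.val_castAdd]
      omega
    have hstep := hstab _ hmem e (by simp) (fun j' hj' => ?_)
      (by simp only [he, Fin.val_castAdd, Fin.val_last]; omega) j
      (by have := hsmall j hj; omega)
    · rwa [Finsupp.single_add, ← add_assoc, add_right_comm _ _ (Finsupp.single j 1),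
        add_tsub_cancel_right, add_right_comm b] at hstep
    · by_cases h : j' = e
      · exact h.le
      · have := hsmall j' (by
          simp only [Finsupp.add_apply, Finsupp.single_apply, Ne.symm h, if_false, add_zero] at hj' ⊢
          omega)
        simpa [Fin.le_def, he] using this

end

/-- Let `I` be a weakly `D`-stable monomial ideal over an infinite field with
`dim (P/I) = D`, and let `α ≥ 1` satisfy `x_{n-D}^α ∈ I` and `x_{n-D}^{α-1} ∉ I`.
Then for every minimal reduction `J = I + ⟨y_1, …, y_D⟩` of `I` (the `y_i` being linear
forms with `P/J` finite-dimensional over `k`), the reduction number `r_J(P/I)`, i.e.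
the largest degree `d` with `(P/J)_d ≠ 0`, equals `α - 1`. -/
theorem reduction_number_of_weaklyDStable
    {k : Type*} [Field k] [Infinite k] {n D : ℕ} (hD : D < n)
    (I : Ideal (MvPolynomial (Fin n) k)) (hmon : IsMonomialIdeal I)
    (hdim : ringKrullDim (MvPolynomial (Fin n) k ⧸ I) = (D : WithBot (WithTop ℕ)))
    (hstab : WeaklyLStable D I)
    (α : ℕ) (hα : 1 ≤ α)
    (hin : X (⟨n - D - 1, by omega⟩ : Fin n) ^ α ∈ I)
    (hnotin : X (⟨n - D - 1, by omega⟩ : Fin n) ^ (α - 1) ∉ I)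
    (y : Fin D → MvPolynomial (Fin n) k)
    (hy : ∀ i, y i ∈ homogeneousSubmodule (Fin n) k 1)
    (J : Ideal (MvPolynomial (Fin n) k))
    (hJ : J = I ⊔ Ideal.span (Set.range y))
    (hfin : FiniteDimensional k (MvPolynomial (Fin n) k ⧸ J)) :
    quotComponent J (α - 1) ≠ ⊥ ∧ ∀ d : ℕ, α - 1 < d → quotComponent J d = ⊥ := by
  obtain ⟨m, rfl⟩ : ∃ m, n = m + 1 + D := ⟨n - D - 1, by omega⟩
  have he : (⟨m + 1 + D - D - 1, by omega⟩ : Fin (m + 1 + D)) = Fin.castAdd D (Fin.last m) := by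
    ext; simp
  rw [he] at hin hnotin
  subst hJ
  have hpow : ∀ i : Fin (m + 1), X (Fin.castAdd D i) ^ α ∈ I := fun i => by
    rw [X_pow_eq_monomial]
    refine hstab.monomial_mem_of_le_degree hin _ (fun l => ?_) (by simp)
    rw [Finsupp.single_apply, if_neg]
    simp only [Fin.ext_iff, Fin.val_castAdd, Fin.val_natAdd]
    omega
  have hlin : ∀ j, ∃ c : Fin (m + 1 + D) → k, ∑ i, c i • X i = y j := fun j => by
    have := hy j
    rwa [homogeneousSubmodule_one_eq_span_X, Submodule.mem_span_range_iff_exists_fun] at this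
  choose c hc using hlin
  let E : Matrix (Fin D) (Fin (m + 1)) k := .of fun j i => c j (Fin.castAdd D i)
  let A : Matrix (Fin D) (Fin D) k := .of fun j l => c j (Fin.natAdd (m + 1) l)
  have hyEA : ∀ j, y j = ∑ i, C (E j i) * X (Fin.castAdd D i) +
      ∑ l, C (A j l) * X (Fin.natAdd (m + 1) l) := fun j => by
    simp only [← hc, Fin.sum_univ_add, smul_eq_C_mul, E, A, Matrix.of_apply]
  have hdet : A.det ≠ 0 := det_ne_zero_of_finiteDimensional
    (fun f hf => projLast_eq_zero_of_mem hdim hpow hf) E A hyEA hfin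
  obtain ⟨g, hgy, hg⟩ := exists_substLast E hdet hyEA
  have hgI : ∀ f ∈ I, substLast g f ∈ I := fun f hf =>
    map_mem_of_monomial_mem _ fun a ha => substLast_monomial_mem g
      (p := fun a => monomial a (1 : k) ∈ I)
      (fun a ha l hl hmax i => hstab a ha _ hl hmax
        (by rw [Fin.val_natAdd]; omega) _ (by rw [Fin.val_castAdd]; omega))
      (fun a ha _ => ha) a (hmon.monomial_mem hf ha)
  constructor
  · intro hbot
    have hmem : Ideal.Quotient.mk (I ⊔ Ideal.span (Set.range y))
        (X (Fin.castAdd D (Fin.last m)) ^ (α - 1)) ∈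
        quotComponent (I ⊔ Ideal.span (Set.range y)) (α - 1) :=
      Submodule.mem_map_of_mem (isHomogeneous_X_pow _ _)
    rw [hbot, Submodule.mem_bot, Ideal.Quotient.eq_zero_iff_mem] at hmem
    have hle : I ⊔ Ideal.span (Set.range y) ≤ I.comap (substLast g) := by
      refine sup_le hgI (Ideal.span_le.mpr ?_)
      rintro _ ⟨j, rfl⟩
      simp [hgy]
    have := hle hmem
    rw [Ideal.mem_comap, map_pow, substLast_castAdd] at this
    exact hnotin this
  · intro d hd
    rw [eq_bot_iff]
    rintro _ ⟨f, hf, rfl⟩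
    refine Ideal.Quotient.eq_zero_iff_mem.mpr ?_
    have hfI : substLast g f ∈ I := map_mem_of_monomial_mem _ fun a ha =>
      substLast_monomial_mem g (p := fun a => α ≤ a.degree)
        (fun a ha l hl _ i => by
          have h : a + Finsupp.single (Fin.castAdd D i) 1 - Finsupp.single (Fin.natAdd (m + 1) l) 1
              + Finsupp.single (Fin.natAdd (m + 1) l) 1 = a + Finsupp.single (Fin.castAdd D i) 1 :=
            tsub_add_cancel_of_le (Finsupp.single_le_iff.mpr (by
              rw [Finsupp.add_apply]; omega))
          have := congrArg Finsupp.degree h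
          simp only [map_add, Finsupp.degree_single] at this
          omega)
        (fun a ha h0 => hstab.monomial_mem_of_le_degree hin a h0 ha) a (by
          have := IsHomogeneous.degree_eq_sum_deg_support hf ha
          rw [← Finsupp.degree_apply] at this
          omega)
    rw [← sub_add_cancel f (substLast g f)]
    exact Ideal.add_mem _ (Ideal.mem_sup_right (hg f)) (Ideal.mem_sup_left hfI)
end

section
/- Let I be a homogeneous ideal in P = k[x_1,…,x_n] over an infinite field k with dim(P/I) = D. Then the reduction number set rSet(P/I) = { r_J(P/I) : J a minimal reduction of I } is a finite subset of the natural numbers. -/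
open MvPolynomial

attribute [local instance] MvPolynomial.gradedAlgebra

lemma quotComponent_eq_bot_iff {k : Type*} [Field k] {n : ℕ}
    {J : Ideal (MvPolynomial (Fin n) k)} {d : ℕ} :
    quotComponent J d = ⊥ ↔ ∀ g ∈ homogeneousSubmodule (Fin n) k d, g ∈ J := by
  simp only [quotComponent, Submodule.eq_bot_iff, Submodule.mem_map, forall_exists_index, and_imp,
    forall_apply_eq_imp_iff₂]
  exact forall₂_congr fun g _ ↦ Ideal.Quotient.eq_zero_iff_mem

/-- The scalars carrying every homogeneous polynomial of degree `d` into the ideal `J`, that is,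
the annihilator of the degree-`d` component of the quotient by `J`. -/
noncomputable def componentAnnihilator {σ R : Type*} [CommRing R] (J : Ideal (MvPolynomial σ R)) (d : ℕ) :
    Ideal R :=
  (J.restrictScalars R).colon (homogeneousSubmodule σ R d : Set (MvPolynomial σ R))

lemma mem_componentAnnihilator {σ R : Type*} [CommRing R] {J : Ideal (MvPolynomial σ R)} {d : ℕ}
    {c : R} : c ∈ componentAnnihilator J d ↔ ∀ g ∈ homogeneousSubmodule σ R d, c • g ∈ J := by
  simp [componentAnnihilator, Submodule.mem_colon]

lemma componentAnnihilator_mono {σ R : Type*} [CommRing R] (J : Ideal (MvPolynomial σ R)) :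
    Monotone (componentAnnihilator J) := by
  refine monotone_nat_of_le_succ fun d c hc ↦ ?_
  rw [mem_componentAnnihilator] at hc ⊢
  intro g hg
  rw [← homogeneousSubmodule_one_pow, pow_succ, homogeneousSubmodule_one_pow] at hg
  induction hg using Submodule.mul_induction_on' with
  | mem_mul_mem a ha b _ =>
    rw [← smul_mul_assoc]
    exact J.mul_mem_right _ (hc a ha)
  | add a _ b _ ha hb =>
    rw [smul_add]
    exact J.add_mem ha hb

lemma quotComponent_eq_bot_iff_one_mem {k : Type*} [Field k] {n : ℕ}
    {J : Ideal (MvPolynomial (Fin n) k)} {d : ℕ} :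
    quotComponent J d = ⊥ ↔ 1 ∈ componentAnnihilator J d := by
  simp [quotComponent_eq_bot_iff, mem_componentAnnihilator]

/-- The generic linear forms `∑ j, a_{ij} x_j`, with indeterminate coefficients `a_{ij}`. -/
noncomputable def genericLinearForm (k ι : Type*) [Field k] (n : ℕ) (i : ι) :
    MvPolynomial (Fin n) (MvPolynomial (ι × Fin n) k) :=
  ∑ j, (X (i, j) : MvPolynomial (ι × Fin n) k) • X j

/-- The ideal generated by `I` and generic linear forms indexed by `ι`. -/
noncomputable def genericReduction {k : Type*} [Field k] (ι : Type*) {n : ℕ}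
    (I : Ideal (MvPolynomial (Fin n) k)) :
    Ideal (MvPolynomial (Fin n) (MvPolynomial (ι × Fin n) k)) :=
  I.map (map C) ⊔ Ideal.span (Set.range (genericLinearForm k ι n))

section Specialization

variable {k ι : Type*} [Field k] {n : ℕ} {I : Ideal (MvPolynomial (Fin n) k)}

lemma map_eval_genericLinearForm (p : ι × Fin n → k) (i : ι) :
    map (eval p) (genericLinearForm k ι n i) = ∑ j, p (i, j) • X j := by
  simp [genericLinearForm, smul_eq_C_mul]

lemma map_eval_map_C (p : ι × Fin n → k) (g : MvPolynomial (Fin n) k) :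
    map (eval p) (map (C : k →+* MvPolynomial (ι × Fin n) k) g) = g := by
  rw [map_map, show (eval p).comp (C : k →+* MvPolynomial (ι × Fin n) k) = RingHom.id k by
    ext; simp, map_id]

lemma map_genericReduction (p : ι × Fin n → k) :
    (genericReduction ι I).map (map (eval p)) =
      I ⊔ Ideal.span (Set.range fun i ↦ ∑ j, p (i, j) • X j) := by
  rw [genericReduction, Ideal.map_sup, Ideal.map_map, Ideal.map_span, ← Set.range_comp]
  congr 2
  · rw [show (map (eval p)).comp (map (C : k →+* MvPolynomial (ι × Fin n) k)) = RingHom.id _ from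
      RingHom.ext (map_eval_map_C p), Ideal.map_id]
  · exact congrArg _ (funext (map_eval_genericLinearForm p))

lemma one_mem_componentAnnihilator_of_eval_ne_zero {d : ℕ} {f : MvPolynomial (ι × Fin n) k}
    (hf : f ∈ componentAnnihilator (genericReduction ι I) d) {p : ι × Fin n → k}
    (hp : eval p f ≠ 0) :
    1 ∈ componentAnnihilator (I ⊔ Ideal.span (Set.range fun i ↦ ∑ j, p (i, j) • X j)) d := by
  rw [mem_componentAnnihilator] at hf ⊢
  intro g hg
  have h := Ideal.mem_map_of_mem (map (eval p)) (hf (map C g) (IsHomogeneous.map hg C))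
  rw [map_genericReduction, smul_eq_C_mul, map_mul, map_C, map_eval_map_C] at h
  rw [one_smul]
  exact (Ideal.unit_mul_mem_iff_mem _ ((isUnit_iff_ne_zero.2 hp).map C)).1 h

lemma exists_homogeneous_decomposition [Finite ι]
    (hhom : I.IsHomogeneous (homogeneousSubmodule (Fin n) k))
    {y : ι → MvPolynomial (Fin n) k} (hy : ∀ i, y i ∈ homogeneousSubmodule (Fin n) k 1)
    {d : ℕ} {g : MvPolynomial (Fin n) k} (hg : g ∈ homogeneousSubmodule (Fin n) k (d + 1))
    (hgJ : g ∈ I ⊔ Ideal.span (Set.range y)) :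
    g ∈ (I.restrictScalars k) ⊔ Submodule.span k
      {f | ∃ h ∈ homogeneousSubmodule (Fin n) k d, ∃ i, f = h * y i} := by
  have := Fintype.ofFinite ι
  obtain ⟨a, ha, b, hb, rfl⟩ := Submodule.mem_sup.1 hgJ
  obtain ⟨c, rfl⟩ := (Submodule.mem_span_range_iff_exists_fun _).1 hb
  rw [← homogeneousComponent_eq_self hg, map_add, map_sum]
  refine Submodule.add_mem_sup (homogeneousComponent_mem_of_mem hhom ha _)
    (Submodule.sum_mem _ fun i _ ↦ Submodule.subset_span
      ⟨homogeneousComponent d (c i), homogeneousComponent_mem d _, i, ?_⟩)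
  have h := DirectSum.coe_decompose_mul_add_of_right_mem (homogeneousSubmodule (Fin n) k)
    (i := d) (a := c i) (hy i)
  rwa [← decomposition.decompose'_apply, ← decomposition.decompose'_apply]

lemma map_C_mem_genericReduction_sup [Finite ι]
    (hhom : I.IsHomogeneous (homogeneousSubmodule (Fin n) k)) {d : ℕ} {p : ι × Fin n → k}
    {g : MvPolynomial (Fin n) k} (hg : g ∈ homogeneousSubmodule (Fin n) k (d + 1))
    (hgJ : g ∈ I ⊔ Ideal.span (Set.range fun i ↦ ∑ j, p (i, j) • X j)) :
    map C g ∈ (genericReduction ι I).restrictScalars (MvPolynomial (ι × Fin n) k) ⊔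
      RingHom.ker (eval p) • homogeneousSubmodule (Fin n) (MvPolynomial (ι × Fin n) k) (d + 1) := by
  have hy (i : ι) : ∑ j, p (i, j) • X j ∈ homogeneousSubmodule (Fin n) k 1 :=
    Submodule.sum_mem _ fun j _ ↦ Submodule.smul_mem _ _ (isHomogeneous_X k j)
  have key := exists_homogeneous_decomposition hhom hy hg hgJ
  obtain ⟨a, ha, b, hb, rfl⟩ := Submodule.mem_sup.1 key
  rw [map_add]
  refine Submodule.add_mem _ (Submodule.mem_sup_left
    (Ideal.mem_sup_left (Ideal.mem_map_of_mem _ ha))) ?_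
  clear hg hgJ key
  induction hb using Submodule.span_induction with
  | zero => simp
  | add x y _ _ hx hy =>
    rw [map_add]
    exact Submodule.add_mem _ hx hy
  | smul c x _ hx =>
    rw [smul_eq_C_mul, map_mul, map_C, ← smul_eq_C_mul]
    exact Submodule.smul_mem _ _ hx
  | mem x hx =>
    obtain ⟨h, hh, i, rfl⟩ := hx
    have e : map C (h * ∑ j, p (i, j) • X j) = map C h * genericLinearForm k ι n i +
        ∑ j, (C (p (i, j)) - X (i, j) : MvPolynomial (ι × Fin n) k) •
          (map C h * X j : MvPolynomial (Fin n) (MvPolynomial (ι × Fin n) k)) := by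
      simp only [genericLinearForm, map_mul, map_sum, smul_eq_C_mul, map_C, map_X, map_sub,
        Finset.mul_sum, ← Finset.sum_add_distrib]
      exact Finset.sum_congr rfl fun j _ ↦ by ring
    rw [e]
    refine Submodule.add_mem_sup (Ideal.mul_mem_left _ _
      (Ideal.mem_sup_right (Ideal.subset_span ⟨i, rfl⟩)))
      (Submodule.sum_mem _ fun j _ ↦ Submodule.smul_mem_smul ?_ ?_)
    · simp [RingHom.mem_ker]
    · exact (IsHomogeneous.map hh C).mul (isHomogeneous_X _ j)

lemma exists_mem_componentAnnihilator_eval_ne_zero [Finite ι]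
    (hhom : I.IsHomogeneous (homogeneousSubmodule (Fin n) k)) {d : ℕ} {p : ι × Fin n → k}
    (hd : 1 ∈ componentAnnihilator (I ⊔ Ideal.span (Set.range fun i ↦ ∑ j, p (i, j) • X j))
      (d + 1)) :
    ∃ f ∈ componentAnnihilator (genericReduction ι I) (d + 1), eval p f ≠ 0 := by
  have hle : homogeneousSubmodule (Fin n) (MvPolynomial (ι × Fin n) k) (d + 1) ≤
      (genericReduction ι I).restrictScalars (MvPolynomial (ι × Fin n) k) ⊔
        RingHom.ker (eval p) •
          homogeneousSubmodule (Fin n) (MvPolynomial (ι × Fin n) k) (d + 1) := by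
    intro g hg
    rw [g.as_sum]
    refine Submodule.sum_mem _ fun m hm ↦ ?_
    have hmon : monomial m (1 : k) ∈ homogeneousSubmodule (Fin n) k (d + 1) :=
      isHomogeneous_monomial _ (IsHomogeneous.degree_eq_sum_deg_support hg hm).symm
    have h := map_C_mem_genericReduction_sup hhom hmon
      (by simpa using mem_componentAnnihilator.1 hd _ hmon)
    have e : monomial m (coeff m g) = coeff m g •
        map (C : k →+* MvPolynomial (ι × Fin n) k) (monomial m 1) := by
      simp [smul_monomial]
    rw [e]
    exact Submodule.smul_mem _ _ h
  obtain ⟨f, hf, hfN⟩ := Submodule.exists_sub_one_mem_and_smul_le_of_fg_of_le_sup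
    (I := RingHom.ker (eval p))
    (N := (genericReduction ι I).restrictScalars (MvPolynomial (ι × Fin n) k))
    (homogeneousSubmodule_fg (σ := Fin n) (R := MvPolynomial (ι × Fin n) k) (d + 1)) le_rfl hle
  refine ⟨f, mem_componentAnnihilator.2 fun g hg ↦
    hfN (Submodule.smul_mem_pointwise_smul g f _ hg), ?_⟩
  rw [RingHom.mem_ker, map_sub, map_one, sub_eq_zero] at hf
  simp [hf]

end Specialization

lemma exists_eq_sum_smul_X {k : Type*} [Field k] {n : ℕ} {y : MvPolynomial (Fin n) k}
    (hy : y ∈ homogeneousSubmodule (Fin n) k 1) : ∃ c : Fin n → k, y = ∑ j, c j • X j := by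
  rw [homogeneousSubmodule_one_eq_span_X, Submodule.mem_span_range_iff_exists_fun] at hy
  exact hy.imp fun _ h ↦ h.symm

/-- Let `I` be a homogeneous ideal in `P = k[x_1, …, x_n]` over an infinite field `k`
with `dim (P/I) = D`.  The reduction number set
`rSet(P/I) = { r_J(P/I) : J a minimal reduction of I }` is finite.  Here a minimal
reduction is an ideal `J = I + ⟨y_1, …, y_D⟩` with linear forms `y_i` such that `P/J`
is a finite-dimensional `k`-vector space, and `r_J(P/I)` is the largest degree `d`
with `(P/J)_d ≠ 0`. -/
theorem rSet_finite
    {k : Type*} [Field k] [Infinite k] {n D : ℕ}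
    (I : Ideal (MvPolynomial (Fin n) k))
    (hhom : Ideal.IsHomogeneous (homogeneousSubmodule (Fin n) k) I)
    (hdim : ringKrullDim (MvPolynomial (Fin n) k ⧸ I) = (D : WithBot (WithTop ℕ))) :
    Set.Finite {r : ℕ | ∃ y : Fin D → MvPolynomial (Fin n) k,
      (∀ i, y i ∈ homogeneousSubmodule (Fin n) k 1) ∧
      FiniteDimensional k (MvPolynomial (Fin n) k ⧸ (I ⊔ Ideal.span (Set.range y))) ∧
      quotComponent (I ⊔ Ideal.span (Set.range y)) r ≠ ⊥ ∧
      ∀ d : ℕ, r < d → quotComponent (I ⊔ Ideal.span (Set.range y)) d = ⊥} := by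
  obtain ⟨N, hN⟩ := monotone_stabilizes_iff_noetherian.2 inferInstance
    (⟨_, componentAnnihilator_mono (genericReduction (Fin D) I)⟩ :
      ℕ →o Ideal (MvPolynomial (Fin D × Fin n) k))
  refine (Set.finite_lt_nat N).subset ?_
  rintro r ⟨y, hy, -, hr, htop⟩
  choose c hc using fun i ↦ exists_eq_sum_smul_X (hy i)
  obtain rfl : y = fun i ↦ ∑ j, (Function.uncurry c) (i, j) • X j := funext hc
  by_contra hrN
  have hNr : N ≤ r := not_lt.1 hrN
  obtain ⟨f, hf, hfp⟩ := exists_mem_componentAnnihilator_eval_ne_zero hhom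
    (quotComponent_eq_bot_iff_one_mem.1 (htop (r + 1) r.lt_succ_self))
  have hfN : f ∈ componentAnnihilator (genericReduction (Fin D) I) N :=
    (hN (r + 1) (by omega)).ge hf
  exact hr (quotComponent_eq_bot_iff_one_mem.2 (componentAnnihilator_mono _ hNr
    (one_mem_componentAnnihilator_of_eval_ne_zero hfN hfp)))
end

section
/- Let I be a monomial ideal in P = k[x_1,…,x_n] generated by a set G of terms, and let 0 ≤ ℓ < n. If for every generator g ∈ G with w(g) ≥ n−ℓ and every i ≤ n−ℓ the term x_i·g/x_{w(g)} lies in I, then I is weakly ℓ-stable, i.e. the defining property of weak ℓ-stability holds for every term t ∈ I. -/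
open MvPolynomial

/-- If a term lies in an ideal, so does every multiple of it. -/
theorem monomial_one_mem_of_le {σ R : Type*} [CommSemiring R] {I : Ideal (MvPolynomial σ R)}
    {a b : σ →₀ ℕ} (hab : a ≤ b) (ha : monomial a (1 : R) ∈ I) : monomial b (1 : R) ∈ I :=
  I.mem_of_dvd (monomial_dvd_monomial.mpr ⟨Or.inr hab, one_dvd 1⟩) ha

/-- To check weak `ℓ`-stability of a monomial ideal it suffices to check the defining
property on a set `G` of generating terms: if for every generator `g ∈ G` (exponent
vector) with `w(g) ≥ n - ℓ` and every `i ≤ n - ℓ` the term `x_i · g / x_{w(g)}` lies in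
`I`, then `I` is weakly `ℓ`-stable. -/
theorem weaklyLStable_of_generators
    {k : Type*} [Field k] {n ℓ : ℕ} (hℓ : ℓ < n)
    (G : Set (Fin n →₀ ℕ)) (I : Ideal (MvPolynomial (Fin n) k))
    (hI : I = Ideal.span ((fun a => monomial a (1 : k)) '' G))
    (hG : ∀ g ∈ G, ∀ w : Fin n, g w ≠ 0 → (∀ j, g j ≠ 0 → j ≤ w) →
      n - ℓ ≤ (w : ℕ) + 1 →
      ∀ i : Fin n, (i : ℕ) + 1 ≤ n - ℓ →
        monomial (g + Finsupp.single i 1 - Finsupp.single w 1) (1 : k) ∈ I) :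
    WeaklyLStable ℓ I := by
  intro a ha w haw hmax hw i hi
  obtain ⟨g, hgG, hga⟩ : ∃ g ∈ G, g ≤ a := by
    rw [hI, mem_ideal_span_monomial_image] at ha
    exact ha a (by simp)
  by_cases hgw : g w = 0
  · have hgI : monomial g (1 : k) ∈ I := hI ▸ Ideal.subset_span ⟨g, hgG, rfl⟩
    refine monomial_one_mem_of_le (fun j => ?_) hgI
    have hj := hga j
    by_cases hjw : j = w
    · simp [hjw, hgw]
    · simp only [Finsupp.tsub_apply, Finsupp.add_apply, Finsupp.single_apply, Ne.symm hjw,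
        if_false]
      omega
  · have hgmax : ∀ j, g j ≠ 0 → j ≤ w := fun j hj =>
      hmax j (Nat.pos_iff_ne_zero.mp ((Nat.pos_of_ne_zero hj).trans_le (hga j)))
    exact monomial_one_mem_of_le (tsub_le_tsub_right (add_le_add_left hga _) _)
      (hG g hgG w hgw hgmax hw i hi)
end

section
/- Let I be a monomial ideal in P = k[x_1,…,x_n] generated by a set G of terms, and let 0 ≤ ℓ < n. If for every generator g ∈ G with w(g) ≥ n−ℓ and every i < w(g) the term x_i·g/x_{w(g)} lies in I, then I is ℓ-stable, i.e. the defining property of ℓ-stability holds for every term t ∈ I. -/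
open MvPolynomial

/-- To check `ℓ`-stability of a monomial ideal it suffices to check the defining
property on a set `G` of generating terms: if for every generator `g ∈ G` (exponent
vector) with `w(g) ≥ n - ℓ` and every `i < w(g)` the term `x_i · g / x_{w(g)}` lies in
`I`, then `I` is `ℓ`-stable. -/
theorem lStable_of_generators
    {k : Type*} [Field k] {n ℓ : ℕ} (hℓ : ℓ < n)
    (G : Set (Fin n →₀ ℕ)) (I : Ideal (MvPolynomial (Fin n) k))
    (hI : I = Ideal.span ((fun a => monomial a (1 : k)) '' G))
    (hG : ∀ g ∈ G, ∀ w : Fin n, g w ≠ 0 → (∀ j, g j ≠ 0 → j ≤ w) →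
      n - ℓ ≤ (w : ℕ) + 1 →
      ∀ i : Fin n, i < w →
        monomial (g + Finsupp.single i 1 - Finsupp.single w 1) (1 : k) ∈ I) :
    LStable ℓ I := by
  intro a ha w hw hmax hwn i hi
  obtain ⟨g, hgG, hga⟩ : ∃ g ∈ G, g ≤ a := by
    rw [hI, mem_ideal_span_monomial_image] at ha
    exact ha a (by simp)
  by_cases hgw : g w = 0
  · have hg : monomial g (1 : k) ∈ I := hI ▸ Ideal.subset_span ⟨g, hgG, rfl⟩
    refine monomial_one_mem_of_le (fun j => ?_) hg
    have := hga j
    rcases eq_or_ne j w with rfl | hj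
    · simp [hgw]
    · simp only [Finsupp.tsub_apply, Finsupp.add_apply, Finsupp.single_eq_of_ne hj]
      omega
  · have hgmax : ∀ j, g j ≠ 0 → j ≤ w := fun j hj =>
      hmax j (ne_of_gt ((Nat.pos_of_ne_zero hj).trans_le (hga j)))
    exact monomial_one_mem_of_le (tsub_le_tsub_right (add_le_add_left hga _) _)
      (hG g hgG w hgw hgmax hwn i hi)
end
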